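/- arXiv:1706.09459 — 7 statements merged into one kernel-verified Lean document; each statement's English description precedes it below -/
import Mathlib

section
/- Let v_F > 0, ε > 0, and δ₊, δ₋ > 1, and let k, ω ∈ ℝ. Then the sum-integral Σ_{m∈ℤ} ∫_ℝ e^{i(ωt − km)} · (i[v_F(t−iε) − m])^{−δ₊} · (i[v_F(t−iε) + m])^{−δ₋} dt converges absolutely and equals ((2π)² e^{−εω})/(2 v_F Γ(δ₊)Γ(δ₋)) · Σ_{n∈ℤ} Ξ(Ω_{+,n}) Ξ(Ω_{−,n}) · Ω_{+,n}^{δ₊−1} Ω_{−,n}^{δ₋−1}, where the sum over n has only finitely many nonzero terms (and is empty when ω ≤ 0). -/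
open MeasureTheory Real

/-- The Heaviside step function `Ξ`. -/
noncomputable def Xi (x : ℝ) : ℝ := if 0 < x then 1 else 0

/-- `Ω_{υ,n} = (ω + υ v_F (k + 2πn))/(2 v_F)`. -/
noncomputable def Omg (vF k ω : ℝ) (υ : ℝ) (n : ℤ) : ℝ :=
  (ω + υ * vF * (k + 2 * π * (n : ℝ))) / (2 * vF)

/-- The integrand `e^{i(ωt − km)} (i[v_F(t−iε) − m])^{−δ₊} (i[v_F(t−iε) + m])^{−δ₋}`. -/
noncomputable def latticeIntegrand (vF ε δp δm k ω : ℝ) (m : ℤ) (t : ℝ) : ℂ :=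
  Complex.exp (Complex.I * ((ω : ℂ) * (t : ℂ) - (k : ℂ) * (m : ℂ))) *
    (Complex.I * ((vF : ℂ) * ((t : ℂ) - Complex.I * (ε : ℂ)) - (m : ℂ))) ^ (-(δp : ℂ)) *
    (Complex.I * ((vF : ℂ) * ((t : ℂ) - Complex.I * (ε : ℂ)) + (m : ℂ))) ^ (-(δm : ℂ))

open Filter Topology Asymptotics

open scoped FourierTransform

section Decay

variable {E : Type*} [NormedAddCommGroup E] {f : ℝ → E} {b : ℝ}

/-- A continuous function decaying like `|x| ^ (-b)` with `1 < b` is integrable. -/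
theorem Continuous.integrable_of_isBigO_rpow_neg (hf : Continuous f) (hb : 1 < b)
    (hO : f =O[cocompact ℝ] fun x : ℝ => |x| ^ (-b)) : Integrable f := by
  have hfi : Integrable (fun x : ℝ => (1 + ‖x‖) ^ (-b)) :=
    integrable_one_add_norm (by simpa using hb)
  refine hf.locallyIntegrable.integrable_of_isBigO_cocompact (hO.trans ?_)
    (hfi.integrableAtFilter _)
  refine IsBigO.of_bound ((2 : ℝ) ^ b) ?_
  filter_upwards [(tendsto_norm_cocompact_atTop (E := ℝ)).eventually_ge_atTop 1] with x hx
  rw [Real.norm_eq_abs] at hx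
  rw [Real.norm_of_nonneg (by positivity), Real.norm_of_nonneg (by positivity), Real.norm_eq_abs]
  calc |x| ^ (-b) ≤ ((1 + |x|) / 2) ^ (-b) :=
        Real.rpow_le_rpow_of_nonpos (by positivity) (by linarith) (by linarith)
    _ = 2 ^ b * (1 + |x|) ^ (-b) := by
        rw [Real.div_rpow (by positivity) (by positivity), Real.rpow_neg zero_le_two, div_inv_eq_mul,
          mul_comm]

/-- The integer translates of a function decaying like `|x| ^ (-b)` with `1 < b` are summable. -/
theorem Asymptotics.IsBigO.summable_add_intCast [CompleteSpace E] (hb : 1 < b)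
    (hO : f =O[cocompact ℝ] fun x : ℝ => |x| ^ (-b)) (x : ℝ) :
    Summable fun n : ℤ => f (x + n) := by
  have ht : Tendsto (fun n : ℤ => x + (n : ℝ)) cofinite (cocompact ℝ) :=
    (Homeomorph.addLeft x).isClosedEmbedding.tendsto_cocompact.comp Int.tendsto_coe_cofinite
  refine summable_of_isBigO ?_ (hO.comp_tendsto ht)
  convert (summable_one_div_int_add_rpow x b).mpr hb using 2 with n
  simp [Real.rpow_neg, add_comm]

end Decay

/-- The function `x ↦ x₊ ^ (δ - 1) * exp (-r x)`. -/
noncomputable def gammaKernel (δ : ℝ) (r : ℂ) (x : ℝ) : ℂ :=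
  ((max x 0 ^ (δ - 1) : ℝ) : ℂ) * Complex.exp (-(r * x))

theorem continuous_gammaKernel {δ : ℝ} (hδ : 1 < δ) (r : ℂ) : Continuous (gammaKernel δ r) := by
  unfold gammaKernel
  have : Continuous fun x : ℝ => max x 0 ^ (δ - 1) :=
    (by fun_prop : Continuous fun x : ℝ => max x 0).rpow_const fun x => Or.inr (by linarith)
  fun_prop

theorem gammaKernel_of_nonpos {δ : ℝ} (hδ : 1 < δ) (r : ℂ) {x : ℝ} (hx : x ≤ 0) :
    gammaKernel δ r x = 0 := by
  simp [gammaKernel, max_eq_right hx, Real.zero_rpow (by linarith : δ - 1 ≠ 0)]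

theorem norm_gammaKernel (δ : ℝ) (r : ℂ) (x : ℝ) :
    ‖gammaKernel δ r x‖ = max x 0 ^ (δ - 1) * Real.exp (-(r.re * x)) := by
  rw [gammaKernel, norm_mul, Complex.norm_exp, Complex.norm_real,
    Real.norm_of_nonneg (Real.rpow_nonneg (le_max_right _ _) _)]
  simp

theorem isBigO_gammaKernel {δ : ℝ} (hδ : 1 < δ) {r : ℂ} (hr : 0 < r.re) (b : ℝ) :
    gammaKernel δ r =O[cocompact ℝ] fun x : ℝ => |x| ^ (-b) := by
  rw [cocompact_eq_atBot_atTop, isBigO_sup]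
  constructor
  · refine IsBigO.of_bound 1 ?_
    filter_upwards [eventually_le_atBot 0] with x hx
    rw [gammaKernel_of_nonpos hδ r hx, norm_zero]
    positivity
  · have h := (isBigO_refl (fun x : ℝ => x ^ (δ - 1)) atTop).mul
      (isLittleO_exp_neg_mul_rpow_atTop hr (-b - (δ - 1))).isBigO
    refine (IsBigO.of_bound 1 ?_).trans (h.trans (IsBigO.of_bound 1 ?_))
    · filter_upwards [eventually_gt_atTop 0] with x hx
      rw [norm_gammaKernel, max_eq_left hx.le, one_mul, neg_mul]
      exact le_abs_self _
    · filter_upwards [eventually_gt_atTop 0] with x hx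
      rw [← Real.rpow_add hx, abs_of_pos hx, one_mul]
      simp

theorem integrable_gammaKernel {δ : ℝ} (hδ : 1 < δ) {r : ℂ} (hr : 0 < r.re) :
    Integrable (gammaKernel δ r) :=
  (continuous_gammaKernel hδ r).integrable_of_isBigO_rpow_neg one_lt_two
    (isBigO_gammaKernel hδ hr 2)

theorem differentiableOn_integral_gammaKernel {δ : ℝ} (hδ : 1 < δ) :
    DifferentiableOn ℂ (fun r => ∫ x, gammaKernel δ r x) {r | 0 < r.re} := by
  intro r hr
  rw [Set.mem_ofPred_eq] at hr
  have hδ' : 1 < δ + 1 := by linarith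
  have hs : {z : ℂ | r.re / 2 < z.re} ∈ 𝓝 r :=
    (isOpen_lt continuous_const Complex.continuous_re).mem_nhds (half_lt_self hr)
  have hr2 : 0 < ((r.re / 2 : ℝ) : ℂ).re := half_pos hr
  refine (hasDerivAt_integral_of_dominated_loc_of_deriv_le
    (F' := fun z x => -gammaKernel (δ + 1) z x)
    (bound := fun x => ‖gammaKernel (δ + 1) ((r.re / 2 : ℝ) : ℂ) x‖) hs
    (.of_forall fun z => (continuous_gammaKernel hδ z).aestronglyMeasurable)
    (integrable_gammaKernel hδ hr)
    (continuous_gammaKernel hδ' r).neg.aestronglyMeasurable (.of_forall fun x z hz => ?_)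
    (integrable_gammaKernel hδ' hr2).norm
    (.of_forall fun x z _ => ?_)).2.differentiableAt.differentiableWithinAt
  · rcases le_or_gt x 0 with hx | hx
    · simp [gammaKernel_of_nonpos hδ' _ hx]
    · rw [norm_neg, norm_gammaKernel, norm_gammaKernel, Complex.ofReal_re]
      have : r.re / 2 < z.re := hz
      gcongr
  · have h : HasDerivAt (fun z : ℂ => gammaKernel δ z x)
        (((max x 0 ^ (δ - 1) : ℝ) : ℂ) * (Complex.exp (-(z * x)) * -(1 * (x : ℂ)))) z :=
      ((((hasDerivAt_id z).mul_const (x : ℂ)).neg).cexp).const_mul _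
    refine h.congr_deriv ?_
    rcases le_or_gt x 0 with hx | hx
    · rw [gammaKernel_of_nonpos hδ' _ hx, max_eq_right hx, Real.zero_rpow (by linarith)]
      simp
    · rw [gammaKernel, max_eq_left hx.le, show δ + 1 - 1 = (δ - 1) + 1 by ring,
        Real.rpow_add_one hx.ne']
      push_cast
      ring

theorem Complex.differentiableOn_cpow_const_re_pos (a : ℂ) :
    DifferentiableOn ℂ (fun r : ℂ => r ^ a) {r | 0 < r.re} := fun _ hr =>
  (differentiableAt_id.cpow_const (Or.inl hr)).differentiableWithinAt

theorem integral_gammaKernel {δ : ℝ} (hδ : 1 < δ) {r : ℂ} (hr : 0 < r.re) :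
    ∫ x, gammaKernel δ r x = Real.Gamma δ * r ^ (-(δ : ℂ)) := by
  have hopen : IsOpen {r : ℂ | 0 < r.re} := isOpen_lt continuous_const Complex.continuous_re
  have h1 : AnalyticOnNhd ℂ (fun r => ∫ x, gammaKernel δ r x) {r | 0 < r.re} :=
    (differentiableOn_integral_gammaKernel hδ).analyticOnNhd hopen
  have h2 : AnalyticOnNhd ℂ (fun r : ℂ => (Real.Gamma δ : ℂ) * r ^ (-(δ : ℂ))) {r | 0 < r.re} :=
    ((Complex.differentiableOn_cpow_const_re_pos _).const_mul _).analyticOnNhd hopen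
  have hconn : IsPreconnected {r : ℂ | 0 < r.re} :=
    (convex_halfSpace_re_gt 0).isPreconnected
  have hreal : ∀ s : ℝ, 0 < s →
      ∫ x, gammaKernel δ s x = Real.Gamma δ * (s : ℂ) ^ (-(δ : ℂ)) := by
    intro s hs
    have h := Real.integral_rpow_mul_exp_neg_mul_Ioi (by linarith : 0 < δ) hs
    rw [← setIntegral_eq_integral_of_forall_compl_eq_zero (s := Set.Ioi 0)
      fun x hx => gammaKernel_of_nonpos hδ _ (not_lt.mp hx)]
    rw [one_div, Real.inv_rpow hs.le, ← Real.rpow_neg hs.le] at h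
    rw [← Complex.ofReal_neg, ← Complex.ofReal_cpow hs.le, ← Complex.ofReal_mul, mul_comm, ← h,
      ← integral_complex_ofReal]
    refine setIntegral_congr_fun measurableSet_Ioi fun x hx => ?_
    simp [gammaKernel, max_eq_left (le_of_lt (Set.mem_Ioi.mp hx))]
  refine h1.eqOn_of_preconnected_of_frequently_eq h2 hconn (z₀ := 1) (by simp) ?_ hr
  have ht : Tendsto ((↑) : ℝ → ℂ) (𝓝[≠] 1) (𝓝[≠] 1) := by
    refine tendsto_nhdsWithin_of_tendsto_nhds_of_eventually_within _ ?_ ?_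
    · exact (Complex.continuous_ofReal.tendsto' 1 1 (by simp)).mono_left nhdsWithin_le_nhds
    · filter_upwards [self_mem_nhdsWithin] with x hx
      simpa using hx
  refine ht.frequently (Eventually.frequently ?_)
  filter_upwards [nhdsWithin_le_nhds (lt_mem_nhds (zero_lt_one (α := ℝ)))] with x hx
  exact hreal x hx

theorem fourier_gammaKernel {δ : ℝ} (hδ : 1 < δ) {r : ℂ} (hr : 0 < r.re) (ξ : ℝ) :
    𝓕 (gammaKernel δ r) ξ =
      Real.Gamma δ * (r + ((2 * π * ξ : ℝ) : ℂ) * Complex.I) ^ (-(δ : ℂ)) := by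
  rw [Real.fourier_real_eq_integral_exp_smul, ← integral_gammaKernel hδ (by simpa using hr)]
  refine integral_congr_ae (.of_forall fun x => ?_)
  simp only [gammaKernel, smul_eq_mul]
  rw [mul_left_comm, ← Complex.exp_add]
  congr 2
  push_cast
  ring

theorem continuous_add_mul_I_cpow {r : ℂ} (hr : 0 < r.re) (a : ℂ) :
    Continuous fun y : ℝ => (r + (y : ℂ) * Complex.I) ^ a :=
  Continuous.cpow (by fun_prop) continuous_const fun y => Or.inl (by simpa using hr)

theorem isBigO_add_mul_I_cpow (r : ℂ) {δ : ℝ} (hδ : 0 < δ) :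
    (fun y : ℝ => (r + (y : ℂ) * Complex.I) ^ (-(δ : ℂ))) =O[cocompact ℝ]
      fun y : ℝ => |y| ^ (-δ) := by
  refine IsBigO.of_bound ((2 : ℝ) ^ δ) ?_
  filter_upwards [(tendsto_norm_cocompact_atTop (E := ℝ)).eventually_ge_atTop (2 * ‖r‖ + 1)]
    with y hy
  rw [Real.norm_eq_abs] at hy
  have hy0 : 0 < |y| := by linarith [norm_nonneg r]
  have h : |y| / 2 ≤ ‖r + (y : ℂ) * Complex.I‖ := by
    have h1 := norm_sub_norm_le ((y : ℂ) * Complex.I) (-r)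
    rw [norm_neg, norm_mul, Complex.norm_I, mul_one, Complex.norm_real, Real.norm_eq_abs,
      sub_neg_eq_add, add_comm ((y : ℂ) * Complex.I)] at h1
    linarith
  rw [← Complex.ofReal_neg, Complex.norm_cpow_real, Real.norm_of_nonneg (by positivity)]
  refine (Real.rpow_le_rpow_of_nonpos (by positivity) h (by linarith)).trans_eq ?_
  rw [Real.div_rpow (by positivity) (by positivity), Real.rpow_neg zero_le_two, div_inv_eq_mul,
    mul_comm]

theorem integrable_add_mul_I_cpow {r : ℂ} (hr : 0 < r.re) {δ : ℝ} (hδ : 1 < δ) :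
    Integrable fun y : ℝ => (r + (y : ℂ) * Complex.I) ^ (-(δ : ℂ)) :=
  (continuous_add_mul_I_cpow hr _).integrable_of_isBigO_rpow_neg hδ
    (isBigO_add_mul_I_cpow r (by linarith))

/-- Fourier inversion for `y ↦ (r + i y) ^ (-δ)`. -/
theorem integral_exp_mul_add_mul_I_cpow {r : ℂ} (hr : 0 < r.re) {δ : ℝ} (hδ : 1 < δ) (s : ℝ) :
    ∫ y : ℝ, Complex.exp ((y * s : ℝ) * Complex.I) * (r + (y : ℂ) * Complex.I) ^ (-(δ : ℂ)) =
      2 * π / Real.Gamma δ * gammaKernel δ r s := by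
  have hΓ : (Real.Gamma δ : ℂ) ≠ 0 :=
    Complex.ofReal_ne_zero.mpr (Real.Gamma_pos_of_pos (by linarith)).ne'
  have hF : 𝓕 (gammaKernel δ r) = fun ξ : ℝ =>
      Real.Gamma δ * (r + ((2 * π * ξ : ℝ) : ℂ) * Complex.I) ^ (-(δ : ℂ)) :=
    funext fun ξ => fourier_gammaKernel hδ hr ξ
  have hfi : Integrable (𝓕 (gammaKernel δ r)) := by
    rw [hF]
    exact ((integrable_add_mul_I_cpow hr hδ).comp_mul_left' (R := 2 * π)
      (by positivity)).const_mul _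
  have h := (integrable_gammaKernel hδ hr).fourierInv_fourier_eq hfi
    (continuous_gammaKernel hδ r).continuousAt (v := s)
  rw [Real.fourierInv_eq', hF] at h
  rw [← h]
  have hsub := Measure.integral_comp_mul_left (fun y : ℝ =>
    Complex.exp ((y * s : ℝ) * Complex.I) * (r + (y : ℂ) * Complex.I) ^ (-(δ : ℂ))) (2 * π)
  have hcongr : ∀ v : ℝ, Complex.exp (((2 * π * inner ℝ v s : ℝ) : ℂ) * Complex.I) •
      ((Real.Gamma δ : ℂ) * (r + ((2 * π * v : ℝ) : ℂ) * Complex.I) ^ (-(δ : ℂ))) =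
      (Real.Gamma δ : ℂ) * (Complex.exp ((2 * π * v * s : ℝ) * Complex.I) *
        (r + ((2 * π * v : ℝ) : ℂ) * Complex.I) ^ (-(δ : ℂ))) := by
    intro v
    rw [smul_eq_mul, mul_left_comm]
    congr 4
    simp only [RCLike.inner_apply, conj_trivial]
    ring_nf
  simp_rw [hcongr]
  rw [integral_const_mul, hsub, abs_of_pos (by positivity), Complex.real_smul, Complex.ofReal_inv]
  have hπ : (π : ℂ) ≠ 0 := Complex.ofReal_ne_zero.mpr pi_ne_zero
  rw [Complex.ofReal_mul, Complex.ofReal_ofNat]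
  generalize (∫ y : ℝ, _ : ℂ) = J
  field_simp

/-- Lipschitz summation: Poisson summation for `x ↦ x₊ ^ (δ - 1) * exp (-r x)`. -/
theorem tsum_gammaKernel {r : ℂ} (hr : 0 < r.re) {δ : ℝ} (hδ : 1 < δ) (x : ℝ) :
    ∑' n : ℤ, gammaKernel δ r (x + n) = Real.Gamma δ * ∑' n : ℤ,
      Complex.exp ((2 * π * n * x : ℝ) * Complex.I) *
        (r + ((2 * π * n : ℝ) : ℂ) * Complex.I) ^ (-(δ : ℂ)) := by
  have hsum : Summable fun n : ℤ => 𝓕 (gammaKernel δ r) n := by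
    refine summable_of_isBigO (Real.summable_abs_int_rpow hδ) ?_
    have ht : Tendsto (fun n : ℤ => 2 * π * (n : ℝ)) cofinite (cocompact ℝ) :=
      (Homeomorph.mulLeft₀ (2 * π) (by positivity)).isClosedEmbedding.tendsto_cocompact.comp
        Int.tendsto_coe_cofinite
    simp_rw [fourier_gammaKernel hδ hr]
    refine (((isBigO_add_mul_I_cpow r (by linarith : 0 < δ)).comp_tendsto ht).const_mul_left
      _).trans ?_
    refine IsBigO.of_bound (|2 * π| ^ (-δ)) (.of_forall fun n => ?_)
    simp only [Function.comp_apply, abs_mul (2 * π),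
      Real.mul_rpow (abs_nonneg (2 * π)) (abs_nonneg _)]
    rw [norm_mul, Real.norm_of_nonneg (Real.rpow_nonneg (abs_nonneg _) _)]
  rw [Real.tsum_eq_tsum_fourier_of_rpow_decay_of_summable (continuous_gammaKernel hδ r) hδ
    (isBigO_gammaKernel hδ hr δ) hsum x, ← tsum_mul_left]
  refine tsum_congr fun n => ?_
  rw [fourier_gammaKernel hδ hr, fourier_coe_apply, mul_assoc, mul_comm (_ ^ _)]
  congr 3
  push_cast
  ring

theorem Complex.ofReal_mul_cpow {s : ℝ} (hs : 0 < s) {w : ℂ} (hw : w ≠ 0) (a : ℂ) :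
    ((s : ℂ) * w) ^ a = (s : ℂ) ^ a * w ^ a := by
  have hs' : (s : ℂ) ≠ 0 := Complex.ofReal_ne_zero.mpr hs.ne'
  rw [Complex.cpow_def_of_ne_zero (mul_ne_zero hs' hw), Complex.cpow_def_of_ne_zero hs',
    Complex.cpow_def_of_ne_zero hw, Complex.log_ofReal_mul hs hw, ← Complex.exp_add,
    Complex.ofReal_log hs.le, add_mul]

/-- Poisson summation for the samples of `y ↦ (c + i y) ^ (-δ)` on a coset of `2 ℤ`. -/
theorem tsum_exp_mul_add_mul_I_cpow {δ c : ℝ} (hδ : 1 < δ) (hc : 0 < c) (θ y : ℝ) :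
    ∑' m : ℤ, Complex.exp ((m * θ : ℝ) * Complex.I) *
        ((c : ℂ) + ((y + 2 * m : ℝ) : ℂ) * Complex.I) ^ (-(δ : ℂ)) =
      ∑' n : ℤ, π / Real.Gamma δ * (gammaKernel δ c (θ / 2 + π * n) *
        Complex.exp (-(y * (θ / 2 + π * n) : ℝ) * Complex.I)) := by
  have hΓ : (Real.Gamma δ : ℂ) ≠ 0 :=
    Complex.ofReal_ne_zero.mpr (Real.Gamma_pos_of_pos (by linarith)).ne'
  have hπ : (π : ℂ) ≠ 0 := Complex.ofReal_ne_zero.mpr pi_ne_zero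
  have hpow : (π : ℂ) ^ (-(δ : ℂ)) ≠ 0 := by simp [Complex.cpow_eq_zero_iff, hπ]
  have h := tsum_gammaKernel (r := (π : ℂ) * (c + y * Complex.I))
    (by simpa using mul_pos pi_pos hc) hδ (θ / (2 * π))
  have hleft : ∀ n : ℤ, gammaKernel δ ((π : ℂ) * (c + y * Complex.I)) (θ / (2 * π) + n) =
      (π : ℂ) ^ (-(δ : ℂ)) * Real.Gamma δ * (π / Real.Gamma δ * (gammaKernel δ c (θ / 2 + π * n) *
        Complex.exp (-(y * (θ / 2 + π * n) : ℝ) * Complex.I))) := by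
    intro n
    have hz : θ / 2 + π * n = π * (θ / (2 * π) + n) := by field_simp
    rw [hz]
    generalize θ / (2 * π) + n = z
    have hmax : max (π * z) 0 = π * max z 0 := by
      rw [mul_max_of_nonneg _ _ pi_pos.le, mul_zero]
    have hexp : Complex.exp (-((π : ℂ) * (c + y * Complex.I) * z)) =
        Complex.exp (-(c * (π * z : ℝ))) *
          Complex.exp (-(y * (π * z) : ℝ) * Complex.I) := by
      rw [← Complex.exp_add]
      congr 1
      push_cast
      ring
    have hpi : (π : ℂ) ^ (-(δ : ℂ)) * π * ((π ^ (δ - 1) : ℝ) : ℂ) = 1 := by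
      rw [← Complex.ofReal_neg, ← Complex.ofReal_cpow pi_pos.le, ← Complex.ofReal_mul,
        ← Complex.ofReal_mul, ← Real.rpow_add_one pi_ne_zero, ← Real.rpow_add pi_pos]
      simp
    have hcancel : (Real.Gamma δ : ℂ) * (π / Real.Gamma δ) = π := mul_div_cancel₀ _ hΓ
    rw [gammaKernel, gammaKernel, hmax, Real.mul_rpow pi_pos.le (le_max_right _ _), hexp,
      Complex.ofReal_mul (π ^ (δ - 1))]
    generalize Complex.exp (-(c * (π * z : ℝ))) = E₁
    generalize Complex.exp (-(y * (π * z) : ℝ) * Complex.I) = E₂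
    linear_combination (-((max z 0 ^ (δ - 1) : ℝ) : ℂ) * E₁ * E₂) * hpi -
      (π : ℂ) ^ (-(δ : ℂ)) * ((π ^ (δ - 1) : ℝ) : ℂ) * ((max z 0 ^ (δ - 1) : ℝ) : ℂ) *
        E₁ * E₂ * hcancel
  have hright : ∀ n : ℤ, Complex.exp ((2 * π * n * (θ / (2 * π)) : ℝ) * Complex.I) *
        ((π : ℂ) * (c + y * Complex.I) + ((2 * π * n : ℝ) : ℂ) * Complex.I) ^ (-(δ : ℂ)) =
      (π : ℂ) ^ (-(δ : ℂ)) * (Complex.exp ((n * θ : ℝ) * Complex.I) *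
        ((c : ℂ) + ((y + 2 * n : ℝ) : ℂ) * Complex.I) ^ (-(δ : ℂ))) := by
    intro n
    have hne : (c : ℂ) + ((y + 2 * n : ℝ) : ℂ) * Complex.I ≠ 0 := fun h0 => by
      simpa [hc.ne'] using congrArg Complex.re h0
    rw [mul_left_comm, ← Complex.ofReal_mul_cpow pi_pos hne]
    congr 2
    · field_simp
    · push_cast
      ring
  rw [tsum_congr hleft, tsum_congr hright, tsum_mul_left, tsum_mul_left, tsum_mul_left] at h
  refine mul_left_cancel₀ (mul_ne_zero hpow hΓ) ?_
  rw [tsum_mul_left, h]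
  ring

theorem norm_add_mul_I_cpow_le {δ : ℝ} (hδ : 0 ≤ δ) {c : ℝ} (hc : 0 < c) {x y : ℝ}
    (h : |x| ≤ |y|) :
    ‖((c : ℂ) + (y : ℂ) * Complex.I) ^ (-(δ : ℂ))‖ ≤
      ‖((c : ℂ) + (x : ℂ) * Complex.I) ^ (-(δ : ℂ))‖ := by
  rw [← Complex.ofReal_neg, Complex.norm_cpow_real, Complex.norm_cpow_real,
    Complex.norm_add_mul_I, Complex.norm_add_mul_I]
  refine Real.rpow_le_rpow_of_nonpos (by positivity) (Real.sqrt_le_sqrt ?_) (by linarith)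
  have := sq_le_sq.mpr h
  linarith

section Product

variable {f g : ℝ → ℂ}

theorem norm_mul_comp_add_le (hf : ∀ x y : ℝ, |x| ≤ |y| → ‖f y‖ ≤ ‖f x‖)
    (hg : ∀ x y : ℝ, |x| ≤ |y| → ‖g y‖ ≤ ‖g x‖) (s y : ℝ) :
    ‖f y * g (y + 2 * s)‖ ≤ ‖f s‖ * ‖g (y + 2 * s)‖ + ‖f y‖ * ‖g s‖ := by
  rw [norm_mul]
  rcases le_total |s| |y| with h | h
  · have := mul_le_mul_of_nonneg_right (hf s y h) (norm_nonneg (g (y + 2 * s)))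
    linarith [mul_nonneg (norm_nonneg (f y)) (norm_nonneg (g s))]
  · have h' : |s| ≤ |y + 2 * s| := by
      have := abs_sub_abs_le_abs_sub (2 * s) (-y)
      rw [abs_mul, abs_two, abs_neg, sub_neg_eq_add, add_comm (2 * s)] at this
      linarith
    have := mul_le_mul_of_nonneg_left (hg s (y + 2 * s) h') (norm_nonneg (f y))
    linarith [mul_nonneg (norm_nonneg (f s)) (norm_nonneg (g (y + 2 * s)))]

theorem integrable_mul_comp_add (hf : ∀ x y : ℝ, |x| ≤ |y| → ‖f y‖ ≤ ‖f x‖)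
    (hg : ∀ x y : ℝ, |x| ≤ |y| → ‖g y‖ ≤ ‖g x‖) (hfi : Integrable f) (hgi : Integrable g)
    (hfc : Continuous f) (hgc : Continuous g) (s : ℝ) :
    Integrable fun y => f y * g (y + 2 * s) :=
  (((hgi.comp_add_right (2 * s)).norm.const_mul _).add (hfi.norm.mul_const _)).mono'
    (by fun_prop) (.of_forall (norm_mul_comp_add_le hf hg s))

theorem summable_integral_norm_mul_comp_add (hf : ∀ x y : ℝ, |x| ≤ |y| → ‖f y‖ ≤ ‖f x‖)
    (hg : ∀ x y : ℝ, |x| ≤ |y| → ‖g y‖ ≤ ‖g x‖) (hfi : Integrable f) (hgi : Integrable g)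
    (hfc : Continuous f) (hgc : Continuous g) (hfs : Summable fun n : ℤ => f n)
    (hgs : Summable fun n : ℤ => g n) :
    Summable fun m : ℤ => ∫ y, ‖f y * g (y + 2 * m)‖ := by
  refine Summable.of_nonneg_of_le (fun m => integral_nonneg fun y => norm_nonneg _) (fun m => ?_)
    ((hfs.norm.mul_right (∫ y, ‖g y‖)).add (hgs.norm.mul_left (∫ y, ‖f y‖)))
  have hgm := (hgi.comp_add_right (2 * (m : ℝ))).norm
  calc ∫ y, ‖f y * g (y + 2 * m)‖
      ≤ ∫ y, (‖f m‖ * ‖g (y + 2 * m)‖ + ‖f y‖ * ‖g m‖) :=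
        integral_mono (integrable_mul_comp_add hf hg hfi hgi hfc hgc m).norm
          ((hgm.const_mul _).add (hfi.norm.mul_const _)) (norm_mul_comp_add_le hf hg m)
    _ = _ := by
        rw [integral_add (hgm.const_mul _) (hfi.norm.mul_const _), integral_const_mul,
          integral_mul_const, integral_add_right_eq_self fun y => ‖g y‖]

end Product

/-- The integrand in the light-cone coordinate `y = v_F t - m`, with `w = ω / v_F` and
`c = v_F ε`. -/
noncomputable def shiftedIntegrand (c w δp δm k : ℝ) (m : ℤ) (y : ℝ) : ℂ :=
  Complex.exp ((w * y + m * (w - k) : ℝ) * Complex.I) *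
    (((c : ℂ) + (y : ℂ) * Complex.I) ^ (-(δp : ℂ)) *
      ((c : ℂ) + ((y + 2 * m : ℝ) : ℂ) * Complex.I) ^ (-(δm : ℂ)))

theorem latticeIntegrand_eq_shiftedIntegrand {vF : ℝ} (hvF : vF ≠ 0) (ε δp δm k ω : ℝ) (m : ℤ)
    (t : ℝ) :
    latticeIntegrand vF ε δp δm k ω m t =
      shiftedIntegrand (vF * ε) (ω / vF) δp δm k m (vF * t - m) := by
  have hv : (vF : ℂ) ≠ 0 := Complex.ofReal_ne_zero.mpr hvF
  rw [latticeIntegrand, shiftedIntegrand, mul_assoc]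
  congr 2
  · push_cast
    field_simp
    ring
  · congr 1
    push_cast
    linear_combination (-(vF : ℂ) * ε) * Complex.I_sq
  · congr 1
    push_cast
    linear_combination (-(vF : ℂ) * ε) * Complex.I_sq

section Shifted

variable {c δp δm : ℝ}

theorem norm_shiftedIntegrand (c w δp δm k : ℝ) (m : ℤ) (y : ℝ) :
    ‖shiftedIntegrand c w δp δm k m y‖ =
      ‖((c : ℂ) + (y : ℂ) * Complex.I) ^ (-(δp : ℂ)) *
        ((c : ℂ) + ((y + 2 * m : ℝ) : ℂ) * Complex.I) ^ (-(δm : ℂ))‖ := by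
  rw [shiftedIntegrand, norm_mul, Complex.norm_exp_ofReal_mul_I, one_mul]

theorem integrable_shiftedIntegrand (hc : 0 < c) (hδp : 1 < δp) (hδm : 1 < δm) (w k : ℝ) (m : ℤ) :
    Integrable (shiftedIntegrand c w δp δm k m) := by
  have hc' : 0 < (c : ℂ).re := hc
  have h := integrable_mul_comp_add
    (f := fun y : ℝ => ((c : ℂ) + (y : ℂ) * Complex.I) ^ (-(δp : ℂ)))
    (g := fun y : ℝ => ((c : ℂ) + (y : ℂ) * Complex.I) ^ (-(δm : ℂ)))
    (fun _ _ => norm_add_mul_I_cpow_le (by linarith) hc)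
    (fun _ _ => norm_add_mul_I_cpow_le (by linarith) hc)
    (integrable_add_mul_I_cpow hc' hδp) (integrable_add_mul_I_cpow hc' hδm)
    (continuous_add_mul_I_cpow hc' _) (continuous_add_mul_I_cpow hc' _) m
  refine h.bdd_mul (c := 1) (Continuous.aestronglyMeasurable (by fun_prop))
    (.of_forall fun y => ?_)
  rw [Complex.norm_exp_ofReal_mul_I]

theorem summable_integral_norm_shiftedIntegrand (hc : 0 < c) (hδp : 1 < δp) (hδm : 1 < δm)
    (w k : ℝ) : Summable fun m : ℤ => ∫ y, ‖shiftedIntegrand c w δp δm k m y‖ := by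
  have hc' : 0 < (c : ℂ).re := hc
  have hsum : ∀ {δ : ℝ}, 1 < δ →
      Summable fun n : ℤ => ((c : ℂ) + ((n : ℝ) : ℂ) * Complex.I) ^ (-(δ : ℂ)) := fun {δ} hδ => by
    simpa using (isBigO_add_mul_I_cpow (c : ℂ) (by linarith : 0 < δ)).summable_add_intCast hδ 0
  simp_rw [norm_shiftedIntegrand]
  exact summable_integral_norm_mul_comp_add
    (f := fun y : ℝ => ((c : ℂ) + (y : ℂ) * Complex.I) ^ (-(δp : ℂ)))
    (g := fun y : ℝ => ((c : ℂ) + (y : ℂ) * Complex.I) ^ (-(δm : ℂ)))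
    (fun _ _ => norm_add_mul_I_cpow_le (by linarith) hc)
    (fun _ _ => norm_add_mul_I_cpow_le (by linarith) hc)
    (integrable_add_mul_I_cpow hc' hδp) (integrable_add_mul_I_cpow hc' hδm)
    (continuous_add_mul_I_cpow hc' _) (continuous_add_mul_I_cpow hc' _) (hsum hδp) (hsum hδm)

theorem summable_gammaKernel_add_pi_mul {δ : ℝ} (hδ : 1 < δ) {r : ℂ} (hr : 0 < r.re) (a : ℝ) :
    Summable fun n : ℤ => gammaKernel δ r (a + π * n) := by
  have ht : Tendsto (fun n : ℤ => a + π * (n : ℝ)) cofinite (cocompact ℝ) :=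
    ((Homeomorph.mulLeft₀ π pi_ne_zero).trans
      (Homeomorph.addLeft a)).isClosedEmbedding.tendsto_cocompact.comp Int.tendsto_coe_cofinite
  refine summable_of_isBigO ?_ ((isBigO_gammaKernel hδ hr 2).comp_tendsto ht)
  refine ((summable_one_div_int_add_rpow (a / π) 2).mpr one_lt_two).mul_left (π ^ (-2 : ℝ))
    |>.congr fun n => ?_
  have : a + π * n = π * (n + a / π) := by field_simp; ring
  rw [Function.comp_apply, this, abs_mul, Real.mul_rpow (abs_nonneg _) (abs_nonneg _),
    abs_of_pos pi_pos, one_div, ← Real.rpow_neg (abs_nonneg _)]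

theorem tsum_integral_shiftedIntegrand (hc : 0 < c) (hδp : 1 < δp) (hδm : 1 < δm) (w k : ℝ) :
    ∑' m : ℤ, ∫ y, shiftedIntegrand c w δp δm k m y =
      2 * π ^ 2 / (Real.Gamma δp * Real.Gamma δm) * ∑' n : ℤ,
        gammaKernel δp c ((w + k) / 2 - π * n) * gammaKernel δm c ((w - k) / 2 + π * n) := by
  have hc' : 0 < (c : ℂ).re := hc
  rw [integral_tsum_of_summable_integral_norm
    (integrable_shiftedIntegrand hc hδp hδm w k)
    (summable_integral_norm_shiftedIntegrand hc hδp hδm w k)]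
  let F : ℤ → ℝ → ℂ := fun n y =>
    π / Real.Gamma δm * gammaKernel δm c ((w - k) / 2 + π * n) *
      (Complex.exp ((y * ((w + k) / 2 - π * n) : ℝ) * Complex.I) *
        ((c : ℂ) + (y : ℂ) * Complex.I) ^ (-(δp : ℂ)))
  have hpt : ∀ y, ∑' m : ℤ, shiftedIntegrand c w δp δm k m y = ∑' n : ℤ, F n y := by
    intro y
    have h1 : ∀ m : ℤ, shiftedIntegrand c w δp δm k m y =
        (Complex.exp ((w * y : ℝ) * Complex.I) *
          ((c : ℂ) + (y : ℂ) * Complex.I) ^ (-(δp : ℂ))) *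
        (Complex.exp ((m * (w - k) : ℝ) * Complex.I) *
          ((c : ℂ) + ((y + 2 * m : ℝ) : ℂ) * Complex.I) ^ (-(δm : ℂ))) := by
      intro m
      rw [shiftedIntegrand, Complex.ofReal_add, add_mul, Complex.exp_add]
      ring
    simp_rw [h1]
    rw [tsum_mul_left, tsum_exp_mul_add_mul_I_cpow hδm hc, ← tsum_mul_left]
    refine tsum_congr fun n => ?_
    have h2 : Complex.exp ((y * ((w + k) / 2 - π * n) : ℝ) * Complex.I) =
        Complex.exp ((w * y : ℝ) * Complex.I) *
          Complex.exp (-(y * ((w - k) / 2 + π * n) : ℝ) * Complex.I) := by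
      rw [← Complex.exp_add]
      congr 1
      push_cast
      ring
    simp only [F, h2]
    ring
  simp_rw [hpt]
  have hfi := integrable_add_mul_I_cpow hc' hδp
  rw [← integral_tsum_of_summable_integral_norm]
  · rw [← tsum_mul_left]
    refine tsum_congr fun n => ?_
    simp only [F]
    rw [integral_const_mul, integral_exp_mul_add_mul_I_cpow hc' hδp]
    field_simp
  · refine fun n => Integrable.const_mul (hfi.bdd_mul (c := 1)
      (Continuous.aestronglyMeasurable (by fun_prop)) (.of_forall fun y => ?_)) _
    rw [Complex.norm_exp_ofReal_mul_I]
  · simp only [F, norm_mul _ (Complex.exp _ * _), norm_mul (Complex.exp _),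
      Complex.norm_exp_ofReal_mul_I, one_mul, integral_const_mul]
    exact ((summable_gammaKernel_add_pi_mul hδm hc' _).mul_left _).norm.mul_right _

end Shifted

theorem Xi_eq_zero {x : ℝ} (hx : x ≤ 0) : Xi x = 0 := if_neg hx.not_gt

theorem gammaKernel_eq_Xi {δ : ℝ} (hδ : 1 < δ) (c x : ℝ) :
    gammaKernel δ c x = ((Xi x * x ^ (δ - 1) * Real.exp (-(c * x)) : ℝ) : ℂ) := by
  rcases le_or_gt x 0 with hx | hx
  · simp [gammaKernel_of_nonpos hδ _ hx, Xi_eq_zero hx]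
  · simp [gammaKernel, Xi, hx, max_eq_left hx.le]

theorem Omg_pos_of_ne_zero {vF k ω a b : ℝ} {n : ℤ}
    (h : Xi (Omg vF k ω 1 n) * Xi (Omg vF k ω (-1) n) *
      (Omg vF k ω 1 n ^ a * Omg vF k ω (-1) n ^ b) ≠ 0) :
    0 < Omg vF k ω 1 n ∧ 0 < Omg vF k ω (-1) n := by
  constructor <;> by_contra! h0 <;> simp [Xi_eq_zero h0] at h

theorem Omg_add_Omg {vF : ℝ} (hvF : vF ≠ 0) (k ω : ℝ) (n : ℤ) :
    Omg vF k ω 1 n + Omg vF k ω (-1) n = ω / vF := by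
  unfold Omg
  field_simp
  ring

theorem Omg_sub_Omg {vF : ℝ} (hvF : vF ≠ 0) (k ω : ℝ) (n : ℤ) :
    Omg vF k ω 1 n - Omg vF k ω (-1) n = k + 2 * π * n := by
  unfold Omg
  field_simp
  ring

/-- Exact evaluation of the regularized discrete/continuous Fourier transform with `W ≡ 1`:
for `v_F, ε > 0` and `δ₊, δ₋ > 1` the sum-integral converges absolutely and equals
`((2π)² e^{−εω})/(2 v_F Γ(δ₊)Γ(δ₋)) Σ_n Ξ(Ω_{+,n})Ξ(Ω_{−,n}) Ω_{+,n}^{δ₊−1} Ω_{−,n}^{δ₋−1}`,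
where the sum over `n` has finitely many nonzero terms and is empty for `ω ≤ 0`. -/
theorem discrete_continuous_fourier_exact (vF ε δp δm k ω : ℝ)
    (hvF : 0 < vF) (hε : 0 < ε) (hδp : 1 < δp) (hδm : 1 < δm) :
    (∀ m : ℤ, Integrable (latticeIntegrand vF ε δp δm k ω m)) ∧
    Summable (fun m : ℤ => ∫ t : ℝ, ‖latticeIntegrand vF ε δp δm k ω m t‖) ∧
    {n : ℤ | Xi (Omg vF k ω 1 n) * Xi (Omg vF k ω (-1) n) *
        (Omg vF k ω 1 n ^ (δp - 1) * Omg vF k ω (-1) n ^ (δm - 1)) ≠ 0}.Finite ∧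
    (ω ≤ 0 → ∀ n : ℤ, Xi (Omg vF k ω 1 n) * Xi (Omg vF k ω (-1) n) *
        (Omg vF k ω 1 n ^ (δp - 1) * Omg vF k ω (-1) n ^ (δm - 1)) = 0) ∧
    (∑' m : ℤ, ∫ t : ℝ, latticeIntegrand vF ε δp δm k ω m t) =
      (((2 * π) ^ 2 * Real.exp (-(ε * ω)) / (2 * vF * Real.Gamma δp * Real.Gamma δm) *
        ∑' n : ℤ, Xi (Omg vF k ω 1 n) * Xi (Omg vF k ω (-1) n) *
          (Omg vF k ω 1 n ^ (δp - 1) * Omg vF k ω (-1) n ^ (δm - 1)) : ℝ) : ℂ) := by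
  have hc : 0 < vF * ε := mul_pos hvF hε
  have hfun : ∀ m : ℤ, latticeIntegrand vF ε δp δm k ω m =
      fun t => shiftedIntegrand (vF * ε) (ω / vF) δp δm k m (vF * t - m) := fun m =>
    funext fun t => latticeIntegrand_eq_shiftedIntegrand hvF.ne' ε δp δm k ω m t
  refine ⟨fun m => ?_, ?_, ?_, fun hω n => ?_, ?_⟩
  · rw [hfun]
    exact ((integrable_shiftedIntegrand hc hδp hδm (ω / vF) k m).comp_sub_right
      (m : ℝ)).comp_mul_left' hvF.ne'
  · have h : ∀ m : ℤ, ∫ t : ℝ, ‖latticeIntegrand vF ε δp δm k ω m t‖ =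
        |vF⁻¹| * ∫ y, ‖shiftedIntegrand (vF * ε) (ω / vF) δp δm k m y‖ := by
      intro m
      rw [hfun, Measure.integral_comp_mul_left (fun x =>
        ‖shiftedIntegrand (vF * ε) (ω / vF) δp δm k m (x - m)‖), smul_eq_mul,
        integral_sub_right_eq_self fun x => ‖shiftedIntegrand (vF * ε) (ω / vF) δp δm k m x‖]
    simp_rw [h]
    exact (summable_integral_norm_shiftedIntegrand hc hδp hδm (ω / vF) k).mul_left _
  · refine (Set.finite_Icc ⌊(-(ω / vF) - k) / (2 * π)⌋ ⌈(ω / vF - k) / (2 * π)⌉).subset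
      fun n hn => ?_
    obtain ⟨h1, h2⟩ := Omg_pos_of_ne_zero hn
    have hadd := Omg_add_Omg hvF.ne' k ω n
    have hsub := Omg_sub_Omg hvF.ne' k ω n
    have hlo : (-(ω / vF) - k) / (2 * π) ≤ n := by
      rw [div_le_iff₀ (by positivity)]
      linarith
    have hhi : n ≤ (ω / vF - k) / (2 * π) := by
      rw [le_div_iff₀ (by positivity)]
      linarith
    exact ⟨by exact_mod_cast (Int.floor_le _).trans hlo,
      by exact_mod_cast hhi.trans (Int.le_ceil _)⟩
  · by_contra h
    obtain ⟨h1, h2⟩ := Omg_pos_of_ne_zero h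
    have hadd := Omg_add_Omg hvF.ne' k ω n
    linarith [div_nonpos_of_nonpos_of_nonneg hω hvF.le]
  · have h : ∀ m : ℤ, ∫ t : ℝ, latticeIntegrand vF ε δp δm k ω m t =
        (vF⁻¹ : ℝ) * ∫ y, shiftedIntegrand (vF * ε) (ω / vF) δp δm k m y := by
      intro m
      rw [hfun, Measure.integral_comp_mul_left (fun x =>
        shiftedIntegrand (vF * ε) (ω / vF) δp δm k m (x - m)), Complex.real_smul,
        abs_of_pos (inv_pos.mpr hvF),
        integral_sub_right_eq_self (shiftedIntegrand (vF * ε) (ω / vF) δp δm k m)]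
    have hterm : ∀ n : ℤ, gammaKernel δp (vF * ε : ℝ) ((ω / vF + k) / 2 - π * (-n : ℤ)) *
        gammaKernel δm (vF * ε : ℝ) ((ω / vF - k) / 2 + π * (-n : ℤ)) =
        ((Real.exp (-(ε * ω)) * (Xi (Omg vF k ω 1 n) * Xi (Omg vF k ω (-1) n) *
          (Omg vF k ω 1 n ^ (δp - 1) * Omg vF k ω (-1) n ^ (δm - 1))) : ℝ) : ℂ) := by
      intro n
      have hadd := Omg_add_Omg hvF.ne' k ω n
      have hsub := Omg_sub_Omg hvF.ne' k ω n
      have hp : (ω / vF + k) / 2 - π * (-n : ℤ) = Omg vF k ω 1 n := by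
        push_cast
        linarith
      have hm : (ω / vF - k) / 2 + π * (-n : ℤ) = Omg vF k ω (-1) n := by
        push_cast
        linarith
      have hexp : Real.exp (-(ε * ω)) = Real.exp (-(vF * ε * Omg vF k ω 1 n)) *
          Real.exp (-(vF * ε * Omg vF k ω (-1) n)) := by
        rw [← Real.exp_add, ← neg_add, ← mul_add, hadd]
        congr 2
        field_simp
      rw [hp, hm, gammaKernel_eq_Xi hδp, gammaKernel_eq_Xi hδm, ← Complex.ofReal_mul, hexp]
      congr 1
      ring
    simp_rw [h]
    rw [tsum_mul_left, tsum_integral_shiftedIntegrand hc hδp hδm,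
      ← (Equiv.neg ℤ).tsum_eq]
    simp only [Equiv.neg_apply]
    rw [tsum_congr hterm, ← Complex.ofReal_tsum, tsum_mul_left]
    push_cast
    field_simp
end

section
/- Let a > 0, δ > 1, and Ω < 0, and let g : ℂ → ℂ be holomorphic on an open set containing the closed upper half-plane H̄ = {z ∈ ℂ : Im z ≥ 0} and bounded on H̄. Then ∫_ℝ e^{−iΩφ} (a − iφ)^{−δ} g(φ) dφ = 0. -/
open MeasureTheory Real

/-- If `f` is holomorphic on the closed upper half-plane and decays there like `‖z‖ ^ (-δ)` with
`1 < δ`, then its integral over the real line vanishes. -/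
theorem integral_ofReal_eq_zero_of_norm_le_rpow {f : ℂ → ℂ} {C δ : ℝ} (hδ : 1 < δ)
    (hf : DifferentiableOn ℂ f {z : ℂ | 0 ≤ z.im})
    (hbd : ∀ z : ℂ, 0 ≤ z.im → z ≠ 0 → ‖f z‖ ≤ C * ‖z‖ ^ (-δ)) :
    ∫ x : ℝ, f x = 0 := by
  by_cases hfi : Integrable fun x : ℝ => f x
  swap
  · exact integral_undef hfi
  have hC : 0 ≤ C := by
    have h := (norm_nonneg _).trans (hbd 1 (by simp) one_ne_zero)
    simpa using h
  have hlim := intervalIntegral_tendsto_integral hfi Filter.tendsto_neg_atTop_atBot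
    Filter.tendsto_id
  refine tendsto_nhds_unique hlim (squeeze_zero_norm' (a := fun R : ℝ => 4 * C * R ^ (-(δ - 1)))
    ?_ ?_)
  swap
  · simpa using (tendsto_rpow_neg_atTop (sub_pos.2 hδ)).const_mul (4 * C)
  filter_upwards [Filter.eventually_gt_atTop 0] with R hR
  have hfar : ∀ z : ℂ, 0 ≤ z.im → R ≤ ‖z‖ → ‖f z‖ ≤ C * R ^ (-δ) := fun z hz hzR =>
    (hbd z hz (norm_pos_iff.1 (hR.trans_le hzR))).trans <|
      mul_le_mul_of_nonneg_left (rpow_le_rpow_of_nonpos hR hzR (by linarith)) hC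
  have hrect := Complex.integral_boundary_rect_eq_zero_of_differentiableOn f
    (-R : ℝ) (R + R * Complex.I) (hf.mono fun z hz => by
      have h := (Complex.mem_reProdIm.1 hz).2
      simp only [Complex.ofReal_im, Complex.add_im, Complex.mul_im, Complex.I_im, Complex.I_re,
        Complex.ofReal_re, mul_one, mul_zero, add_zero, zero_add, Set.uIcc_of_le hR.le] at h
      exact h.1)
  simp only [Complex.ofReal_im, Complex.add_im, Complex.mul_im, Complex.I_im, Complex.I_re,
    Complex.ofReal_re, Complex.add_re, Complex.mul_re, mul_one, mul_zero, add_zero, zero_add,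
    sub_zero, Complex.ofReal_zero, zero_mul] at hrect
  have htop : ‖∫ x : ℝ in -R..R, f (x + R * Complex.I)‖ ≤ C * R ^ (-δ) * |R - -R| :=
    intervalIntegral.norm_integral_le_of_norm_le_const fun x _ => hfar _ (by simpa using hR.le) <| by
      simpa [abs_of_pos hR] using Complex.abs_im_le_norm (x + R * Complex.I)
  have hside : ∀ c : ℝ, |c| = R →
      ‖∫ y : ℝ in (0 : ℝ)..R, f (c + y * Complex.I)‖ ≤ C * R ^ (-δ) * |R - 0| := fun c hc =>
    intervalIntegral.norm_integral_le_of_norm_le_const fun y hy => by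
      rw [Set.uIoc_of_le hR.le] at hy
      refine hfar _ (by simpa using hy.1.le) ?_
      simpa [hc] using Complex.abs_re_le_norm (c + y * Complex.I)
  have hright := hside R (abs_of_pos hR)
  have hleft := hside (-R) (by rw [abs_neg, abs_of_pos hR])
  have heq : ∫ x : ℝ in -R..R, f x = (∫ x : ℝ in -R..R, f (x + R * Complex.I)) -
      Complex.I • (∫ y : ℝ in (0 : ℝ)..R, f (R + y * Complex.I)) +
      Complex.I • (∫ y : ℝ in (0 : ℝ)..R, f ((-R : ℝ) + y * Complex.I)) := by
    linear_combination (norm := skip) hrect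
    simp only [smul_eq_mul]
    ring
  have hpow : R ^ (-(δ - 1)) = R ^ (-δ) * R := by
    rw [← rpow_add_one hR.ne']; congr 1; ring
  simp only [id_eq, heq]
  refine (norm_add_le_of_le (norm_sub_le_of_le htop ((norm_smul _ _).le.trans ?_))
    ((norm_smul _ _).le.trans ?_)).trans_eq (b := C * R ^ (-δ) * |R - -R| + C * R ^ (-δ) * |R - 0| +
      C * R ^ (-δ) * |R - 0|) ?_
  · simpa using hright
  · simpa using hleft
  · rw [hpow, sub_zero, sub_neg_eq_add, abs_of_pos hR, abs_of_pos (add_pos hR hR)]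
    ring

open MeasureTheory Real

/-- Paley–Wiener-type vanishing lemma: for `a > 0`, `δ > 1`, `Ω < 0` and `g` holomorphic on an
open set containing the closed upper half-plane and bounded there, the integral
`∫_ℝ e^{−iΩφ} (a − iφ)^{−δ} g(φ) dφ` vanishes. -/
theorem paley_wiener_vanishing (a δ Ω : ℝ) (ha : 0 < a) (hδ : 1 < δ) (hΩ : Ω < 0)
    (g : ℂ → ℂ) (U : Set ℂ) (hUopen : IsOpen U) (hUH : {z : ℂ | 0 ≤ z.im} ⊆ U)
    (hg : DifferentiableOn ℂ g U)
    (Mg : ℝ) (hbd : ∀ z : ℂ, 0 ≤ z.im → ‖g z‖ ≤ Mg) :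
    (∫ φ : ℝ, Complex.exp (-Complex.I * (Ω : ℂ) * (φ : ℂ)) *
        ((a : ℂ) - Complex.I * (φ : ℂ)) ^ (-(δ : ℂ)) * g (φ : ℂ)) = 0 := by
  have hre : ∀ z : ℂ, ((a : ℂ) - Complex.I * z).re = a + z.im := by simp
  refine integral_ofReal_eq_zero_of_norm_le_rpow (C := Mg) (f := fun z =>
    Complex.exp (-Complex.I * Ω * z) * ((a : ℂ) - Complex.I * z) ^ (-(δ : ℂ)) * g z) hδ
    (fun z hz => ?_) fun z hz hz0 => ?_
  · have hslit : (a : ℂ) - Complex.I * z ∈ Complex.slitPlane := by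
      refine Or.inl ?_
      rw [hre]
      exact add_pos_of_pos_of_nonneg ha hz
    have hgz : DifferentiableAt ℂ g z := hg.differentiableAt (hUopen.mem_nhds (hUH hz))
    have hpow : DifferentiableAt ℂ (fun w : ℂ => ((a : ℂ) - Complex.I * w) ^ (-(δ : ℂ))) z :=
      DifferentiableAt.cpow (by fun_prop) (by fun_prop) hslit
    have hexp : DifferentiableAt ℂ (fun w : ℂ => Complex.exp (-Complex.I * Ω * w)) z := by
      fun_prop
    exact ((hexp.mul hpow).mul hgz).differentiableWithinAt
  · have hexp : ‖Complex.exp (-Complex.I * Ω * z)‖ ≤ 1 := by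
      rw [Complex.norm_exp, exp_le_one_iff]
      simpa using mul_nonpos_of_nonpos_of_nonneg hΩ.le hz
    have hle : ‖z‖ ≤ ‖(a : ℂ) - Complex.I * z‖ := by
      rw [← sq_le_sq₀ (norm_nonneg _) (norm_nonneg _), Complex.sq_norm, Complex.sq_norm,
        Complex.normSq_apply, Complex.normSq_apply, hre]
      have him : ((a : ℂ) - Complex.I * z).im = -z.re := by simp
      rw [him]
      nlinarith [mul_nonneg ha.le hz, sq_nonneg a]
    have hpow : ‖((a : ℂ) - Complex.I * z) ^ (-(δ : ℂ))‖ ≤ ‖z‖ ^ (-δ) := by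
      rw [← Complex.ofReal_neg, Complex.norm_cpow_real]
      exact rpow_le_rpow_of_nonpos (norm_pos_iff.2 hz0) hle (by linarith)
    calc ‖Complex.exp (-Complex.I * Ω * z) * ((a : ℂ) - Complex.I * z) ^ (-(δ : ℂ)) * g z‖
        ≤ 1 * ‖z‖ ^ (-δ) * Mg := by
          rw [norm_mul, norm_mul]
          gcongr
          exact hbd z hz
      _ = Mg * ‖z‖ ^ (-δ) := by ring
end

section
/- Let a > 0, δ₊, δ₋ > 1, and Ω₊, Ω₋ ∈ ℝ with Ω₊ < 0 or Ω₋ < 0. Let W : ℂ × ℂ → ℂ be holomorphic on an open set containing H̄ × H̄ (where H̄ = {z ∈ ℂ : Im z ≥ 0}) and bounded on H̄ × H̄. Then ∫_ℝ ∫_ℝ e^{−i(Ω₊φ₊ + Ω₋φ₋)} (a − iφ₊)^{−δ₊} (a − iφ₋)^{−δ₋} W(φ₊, φ₋) dφ₊ dφ₋ = 0. -/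
open MeasureTheory Real

open Filter Topology in
/-- A function holomorphic on the closed upper half-plane and bounded there by a multiple of
`max(|Re z|, Im z)^{-δ}` with `δ > 1` has zero integral over the real line. -/
theorem integral_eq_zero_of_upperHalfPlane_decay {g : ℂ → ℂ} {M δ : ℝ} (hδ : 1 < δ)
    (hg : ∀ z : ℂ, 0 ≤ z.im → DifferentiableAt ℂ g z)
    (hdecay : ∀ z : ℂ, ∀ R : ℝ, 0 < R → 0 ≤ z.im → (R ≤ |z.re| ∨ R ≤ z.im) →
      ‖g z‖ ≤ M * R ^ (-δ)) :
    ∫ x : ℝ, g x = 0 := by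
  by_cases hint : Integrable fun x : ℝ => g x
  swap
  · exact integral_undef hint
  have hlim : Tendsto (fun R : ℝ => ∫ x in (-R)..R, g x) atTop (𝓝 (∫ x : ℝ, g x)) :=
    intervalIntegral_tendsto_integral hint tendsto_neg_atTop_atBot tendsto_id
  refine tendsto_nhds_unique hlim ?_
  have hzero : Tendsto (fun R : ℝ => 4 * M * R ^ (-(δ - 1))) atTop (𝓝 0) := by
    simpa using (tendsto_rpow_neg_atTop (sub_pos.2 hδ)).const_mul (4 * M)
  refine squeeze_zero_norm' ?_ hzero
  filter_upwards [eventually_gt_atTop 0] with R hR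
  have hrect := Complex.integral_boundary_rect_eq_zero_of_differentiableOn g
    (-R : ℂ) (R + R * Complex.I) fun z hz => by
      have him : z.im ∈ Set.uIcc 0 R := by simpa using hz.2
      rw [Set.uIcc_of_le hR.le] at him
      exact (hg z him.1).differentiableWithinAt
  simp only [Complex.neg_re, Complex.ofReal_re, Complex.neg_im, Complex.ofReal_im, neg_zero,
    Complex.add_re, Complex.mul_re, Complex.I_re, mul_zero, Complex.I_im, mul_one, sub_self,
    add_zero, Complex.add_im, Complex.mul_im, zero_add, Complex.ofReal_zero, zero_mul,
    smul_eq_mul] at hrect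
  have htop : ‖∫ x : ℝ in (-R)..R, g (x + R * Complex.I)‖ ≤ M * R ^ (-δ) * |R - -R| :=
    intervalIntegral.norm_integral_le_of_norm_le_const fun x _ =>
      hdecay _ R hR (by simp [hR.le]) (by simp)
  have hright : ‖∫ y : ℝ in (0 : ℝ)..R, g (R + y * Complex.I)‖ ≤ M * R ^ (-δ) * |R - 0| :=
    intervalIntegral.norm_integral_le_of_norm_le_const fun y hy => by
      rw [Set.uIoc_of_le hR.le] at hy
      exact hdecay _ R hR (by simp [hy.1.le]) (by simp [le_abs_self])
  have hleft : ‖∫ y : ℝ in (0 : ℝ)..R, g ((-R : ℝ) + y * Complex.I)‖ ≤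
      M * R ^ (-δ) * |R - 0| :=
    intervalIntegral.norm_integral_le_of_norm_le_const fun y hy => by
      rw [Set.uIoc_of_le hR.le] at hy
      exact hdecay _ R hR (by simp [hy.1.le]) (by simp [le_abs_self])
  have hpow : R ^ (-(δ - 1)) = R ^ (-δ) * R := by
    rw [← rpow_add_one hR.ne']
    ring_nf
  rw [sub_neg_eq_add, abs_of_pos (by positivity)] at htop
  rw [sub_zero, abs_of_pos hR] at hright hleft
  have hbottom : ∫ x : ℝ in (-R)..R, g x =
      (∫ x : ℝ in (-R)..R, g (x + R * Complex.I)) -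
        Complex.I * (∫ y : ℝ in (0 : ℝ)..R, g (R + y * Complex.I)) +
        Complex.I * ∫ y : ℝ in (0 : ℝ)..R, g ((-R : ℝ) + y * Complex.I) := by
    linear_combination hrect
  rw [hbottom, hpow]
  refine (norm_add_le_of_le (norm_sub_le _ _) le_rfl).trans ?_
  simp only [norm_mul, Complex.norm_I, one_mul]
  linarith

theorem norm_sub_I_mul_cpow_neg {a : ℝ} (ha : 0 < a) (δ : ℝ) {z : ℂ} (hz : 0 ≤ z.im) :
    ‖((a : ℂ) - Complex.I * z) ^ (-(δ : ℂ))‖ = ‖(a : ℂ) - Complex.I * z‖ ^ (-δ) := by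
  have hne : (a : ℂ) - Complex.I * z ≠ 0 := fun h => by
    have := congrArg Complex.re h
    simp at this
    linarith
  rw [Complex.norm_cpow_of_ne_zero hne]
  simp

theorem sub_I_mul_mem_slitPlane {a : ℝ} (ha : 0 < a) {z : ℂ} (hz : 0 ≤ z.im) :
    (a : ℂ) - Complex.I * z ∈ Complex.slitPlane := by
  left
  simp
  linarith

/-- The one-variable Paley–Wiener vanishing on the upper half-plane. -/
theorem integral_exp_mul_cpow_mul_eq_zero {a δ Ω M : ℝ} (ha : 0 < a) (hδ : 1 < δ) (hΩ : Ω ≤ 0)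
    {F : ℂ → ℂ} (hF : ∀ z : ℂ, 0 ≤ z.im → DifferentiableAt ℂ F z)
    (hM : ∀ z : ℂ, 0 ≤ z.im → ‖F z‖ ≤ M) :
    ∫ x : ℝ, Complex.exp (-Complex.I * (Ω * x)) *
      ((a : ℂ) - Complex.I * x) ^ (-(δ : ℂ)) * F x = 0 := by
  refine integral_eq_zero_of_upperHalfPlane_decay
    (g := fun z => Complex.exp (-Complex.I * (Ω * z)) *
      ((a : ℂ) - Complex.I * z) ^ (-(δ : ℂ)) * F z) (M := M) hδ (fun z hz => ?_)
    fun z R hR hz hRz => ?_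
  · refine DifferentiableAt.mul (DifferentiableAt.mul (by fun_prop) ?_) (hF z hz)
    exact DifferentiableAt.cpow (by fun_prop) (by fun_prop) (sub_I_mul_mem_slitPlane ha hz)
  · have hnorm : R ≤ ‖(a : ℂ) - Complex.I * z‖ := by
      rcases hRz with h | h
      · refine h.trans ?_
        simpa using Complex.abs_im_le_norm ((a : ℂ) - Complex.I * z)
      · refine le_trans ?_ (Complex.re_le_norm _)
        simp
        linarith
    have hexp : ‖Complex.exp (-Complex.I * (Ω * z))‖ ≤ 1 := by
      rw [Complex.norm_exp, Real.exp_le_one_iff]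
      simpa using mul_nonpos_of_nonpos_of_nonneg hΩ hz
    have hM0 : 0 ≤ M := (norm_nonneg _).trans (hM z hz)
    rw [norm_mul, norm_mul, norm_sub_I_mul_cpow_neg ha δ hz]
    calc _ ≤ 1 * R ^ (-δ) * M :=
          mul_le_mul (mul_le_mul hexp (rpow_le_rpow_of_nonpos hR hnorm (by linarith))
            (by positivity) zero_le_one) (hM z hz) (norm_nonneg _) (by positivity)
      _ = M * R ^ (-δ) := by ring

theorem continuous_sub_I_mul_cpow_neg {a : ℝ} (ha : 0 < a) (δ : ℝ) :
    Continuous fun x : ℝ => ((a : ℂ) - Complex.I * x) ^ (-(δ : ℂ)) :=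
  Continuous.cpow (by fun_prop) continuous_const fun x => sub_I_mul_mem_slitPlane ha (by simp)

theorem integrable_sub_I_mul_cpow_neg {a δ : ℝ} (ha : 0 < a) (hδ : 1 < δ) :
    Integrable fun x : ℝ => ((a : ℂ) - Complex.I * x) ^ (-(δ : ℂ)) := by
  have hJ : Integrable fun x : ℝ => (1 + ‖x‖) ^ (-δ) := integrable_one_add_norm (by simpa using hδ)
  refine (hJ.const_mul ((a / (1 + a)) ^ (-δ))).mono'
    (continuous_sub_I_mul_cpow_neg ha δ).aestronglyMeasurable (.of_forall fun x => ?_)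
  rw [norm_sub_I_mul_cpow_neg ha δ (by simp), ← mul_rpow (by positivity) (by positivity)]
  refine rpow_le_rpow_of_nonpos (by positivity) ?_ (by linarith)
  have hre : a ≤ ‖(a : ℂ) - Complex.I * x‖ := by
    simpa using Complex.re_le_norm ((a : ℂ) - Complex.I * x)
  have him : |x| ≤ ‖(a : ℂ) - Complex.I * x‖ := by
    simpa using Complex.abs_im_le_norm ((a : ℂ) - Complex.I * x)
  rw [div_mul_eq_mul_div, div_le_iff₀ (by positivity), norm_eq_abs]
  nlinarith

/-- Two-dimensional Paley–Wiener-type vanishing: for `a > 0`, `δ₊, δ₋ > 1` and frequencies with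
`Ω₊ < 0` or `Ω₋ < 0`, and `W` holomorphic on an open set containing `H̄ × H̄` and bounded there,
the double integral `∫∫ e^{−i(Ω₊φ₊+Ω₋φ₋)} (a−iφ₊)^{−δ₊}(a−iφ₋)^{−δ₋} W(φ₊,φ₋) dφ₊ dφ₋`
vanishes. -/
theorem double_paley_wiener_vanishing (a δp δm Ωp Ωm : ℝ)
    (ha : 0 < a) (hδp : 1 < δp) (hδm : 1 < δm) (hΩ : Ωp < 0 ∨ Ωm < 0)
    (W : ℂ × ℂ → ℂ) (U : Set (ℂ × ℂ)) (hUopen : IsOpen U)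
    (hUH : {z : ℂ | 0 ≤ z.im} ×ˢ {z : ℂ | 0 ≤ z.im} ⊆ U)
    (hW : DifferentiableOn ℂ W U)
    (MW : ℝ) (hbd : ∀ z ∈ {z : ℂ | 0 ≤ z.im} ×ˢ {z : ℂ | 0 ≤ z.im}, ‖W z‖ ≤ MW) :
    (∫ φp : ℝ, ∫ φm : ℝ,
        Complex.exp (-Complex.I * ((Ωp : ℂ) * (φp : ℂ) + (Ωm : ℂ) * (φm : ℂ))) *
          ((a : ℂ) - Complex.I * (φp : ℂ)) ^ (-(δp : ℂ)) *
          ((a : ℂ) - Complex.I * (φm : ℂ)) ^ (-(δm : ℂ)) *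
          W ((φp : ℂ), (φm : ℂ))) = 0 := by
  have hdiff : ∀ z : ℂ × ℂ, 0 ≤ z.1.im → 0 ≤ z.2.im → DifferentiableAt ℂ W z := fun z h₁ h₂ =>
    hW.differentiableAt (hUopen.mem_nhds (hUH ⟨h₁, h₂⟩))
  have hinner : ∀ {Ω δ : ℝ} {F : ℂ → ℂ} (c : ℂ), Ω ≤ 0 → 1 < δ →
      (∀ z : ℂ, 0 ≤ z.im → DifferentiableAt ℂ F z) → (∀ z : ℂ, 0 ≤ z.im → ‖F z‖ ≤ MW) →
      ∫ x : ℝ, c * (Complex.exp (-Complex.I * (Ω * x)) *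
        ((a : ℂ) - Complex.I * x) ^ (-(δ : ℂ)) * F x) = 0 := fun c hΩ hδ hF hM => by
    rw [integral_const_mul, integral_exp_mul_cpow_mul_eq_zero ha hδ hΩ hF hM, mul_zero]
  rcases hΩ with hΩ | hΩ
  · rw [integral_integral_swap]
    · refine integral_eq_zero_of_ae (.of_forall fun y => ?_)
      refine Eq.trans (integral_congr_ae (.of_forall fun x => ?_)) (hinner
        (F := fun z => W (z, y)) (Complex.exp (-Complex.I * (Ωm * y)) *
          ((a : ℂ) - Complex.I * y) ^ (-(δm : ℂ))) hΩ.le hδp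
        (fun z hz => (hdiff (z, y) hz (by simp)).comp z (f := fun z : ℂ => (z, (y : ℂ)))
          (by fun_prop))
        fun z hz => hbd (z, y) ⟨hz, by simp⟩)
      simp only [mul_add, Complex.exp_add]
      ring
    · have hWc : Continuous fun p : ℝ × ℝ => W ((p.1 : ℂ), (p.2 : ℂ)) :=
        continuous_iff_continuousAt.2 fun p =>
          ContinuousAt.comp (f := fun p : ℝ × ℝ => ((p.1 : ℂ), (p.2 : ℂ)))
            (hdiff ((p.1 : ℂ), (p.2 : ℂ)) (by simp) (by simp)).continuousAt
            (by fun_prop)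
      have hprod := ((integrable_sub_I_mul_cpow_neg ha hδp).mul_prod
        (integrable_sub_I_mul_cpow_neg ha hδm)).norm.mul_const MW
      have hcp := (continuous_sub_I_mul_cpow_neg ha δp).comp (continuous_fst (X := ℝ) (Y := ℝ))
      have hcm := (continuous_sub_I_mul_cpow_neg ha δm).comp (continuous_snd (X := ℝ) (Y := ℝ))
      refine hprod.mono' (Continuous.aestronglyMeasurable ?_) (.of_forall fun p => ?_)
      · exact (((by fun_prop : Continuous fun p : ℝ × ℝ => Complex.exp
          (-Complex.I * ((Ωp : ℂ) * (p.1 : ℂ) + (Ωm : ℂ) * (p.2 : ℂ)))).mul hcp).mul hcm).mul hWc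
      · have hexp : ‖Complex.exp
            (-Complex.I * ((Ωp : ℂ) * (p.1 : ℂ) + (Ωm : ℂ) * (p.2 : ℂ)))‖ = 1 := by
          rw [Complex.norm_exp]
          simp
        simp only [Function.uncurry, norm_mul, hexp, one_mul]
        gcongr
        exact hbd _ ⟨by simp, by simp⟩
  · refine integral_eq_zero_of_ae (.of_forall fun x => ?_)
    refine Eq.trans (integral_congr_ae (.of_forall fun y => ?_)) (hinner
      (F := fun z => W (x, z)) (Complex.exp (-Complex.I * (Ωp * x)) *
        ((a : ℂ) - Complex.I * x) ^ (-(δp : ℂ))) hΩ.le hδm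
      (fun z hz => (hdiff (x, z) (by simp) hz).comp z (f := fun z : ℂ => ((x : ℂ), z))
        (by fun_prop))
      fun z hz => hbd (x, z) ⟨by simp, hz⟩)
    simp only [mul_add, Complex.exp_add]
    ring
end

section
/- For every ν ∈ ℂ \ ℤ and every z ∈ ℂ with |z| < 1, the family z^{J(Z)} · R(Z | ν), indexed by all particle–hole configurations Z with equally many particles and holes (n_p = n_h), is absolutely summable, and Σ_Z z^{J(Z)} R(Z | ν) = (1 − z)^{−ν²}, where the sum includes the empty configuration (contributing 1). -/
open Real BigOperators

/-- A particle–hole configuration: two strictly increasing finite sequences of nonnegative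
integers (the particles `p` and the holes `h`), either of which may be empty. -/
structure PHConfig where
  np : ℕ
  nh : ℕ
  p : Fin np → ℕ
  h : Fin nh → ℕ
  p_mono : StrictMono p
  h_mono : StrictMono h

/-- The weight `R(Z | ν)` of a particle–hole configuration. -/
noncomputable def Rweight (Z : PHConfig) (ν : ℂ) : ℂ :=
  (Complex.sin ((π : ℂ) * ν) / (π : ℂ)) ^ (2 * Z.nh) *
  ((∏ a : Fin Z.nh, ∏ b : Fin Z.nh, if a < b then ((Z.h a : ℂ) - (Z.h b : ℂ)) ^ 2 else 1) *
    (∏ a : Fin Z.np, ∏ b : Fin Z.np, if a < b then ((Z.p a : ℂ) - (Z.p b : ℂ)) ^ 2 else 1) /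
    ∏ a : Fin Z.nh, ∏ b : Fin Z.np, ((Z.h a : ℂ) + (Z.p b : ℂ) + 1) ^ 2) *
  (∏ a : Fin Z.np, Complex.Gamma (1 + (Z.p a : ℂ) + ν) ^ 2 / Complex.Gamma (1 + (Z.p a : ℂ)) ^ 2) *
  (∏ a : Fin Z.nh, Complex.Gamma (1 + (Z.h a : ℂ) - ν) ^ 2 / Complex.Gamma (1 + (Z.h a : ℂ)) ^ 2)

/-- The total momentum `J(Z) = Σ_a p_a + Σ_a (h_a + 1)` of a configuration. -/
def Jmom (Z : PHConfig) : ℕ := (∑ a : Fin Z.np, Z.p a) + ∑ a : Fin Z.nh, (Z.h a + 1)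

theorem det_updateRow_eq_sum_adjugate {n R : Type*} [Fintype n] [DecidableEq n] [CommRing R]
    (A : Matrix n n R) (i : n) (b : n → R) :
    (A.updateRow i b).det = ∑ j, b j * A.adjugate j i := by
  rw [← Matrix.cramer_transpose_apply, Matrix.cramer_eq_adjugate_mulVec,
    ← Matrix.adjugate_transpose]
  simp [Matrix.mulVec, dotProduct, mul_comm]

theorem sum_det_updateRow_mul {n R : Type*} [Fintype n] [DecidableEq n] [CommRing R]
    (A : Matrix n n R) (c : n → R) :
    ∑ i, (A.updateRow i fun j => c j * A i j).det = (∑ j, c j) * A.det := by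
  simp_rw [det_updateRow_eq_sum_adjugate]
  rw [Finset.sum_comm, Finset.sum_mul]
  refine Finset.sum_congr rfl fun j _ => ?_
  rw [Matrix.det_eq_sum_mul_adjugate_col A j, Finset.mul_sum]
  exact Finset.sum_congr rfl fun i _ => by ring

theorem sum_mul_det_vandermonde_sub_single {R : Type*} [CommRing R] [IsDomain R] {k : ℕ}
    (x : Fin k → R) :
    ∑ i, x i * (Matrix.vandermonde (x - Pi.single i 1)).det =
      (∑ i, x i - ∑ i : Fin k, ((i : ℕ) : R)) * (Matrix.vandermonde x).det := by
  have key : ∀ v : Fin k → R, (Matrix.vandermonde v).det =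
      (Matrix.of fun i j : Fin k => (descPochhammer R j).eval (v i)).det := fun v =>
    Matrix.det_eval_matrixOfPolynomials_eq_det_vandermonde v _
      (fun i => descPochhammer_natDegree R i) fun i => monic_descPochhammer R i
  set A : Matrix (Fin k) (Fin k) R := Matrix.of fun i j => (descPochhammer R j).eval (x i) with hA
  have row : ∀ i, x i * (Matrix.vandermonde (x - Pi.single i 1)).det =
      x i * A.det - (A.updateRow i fun j => ((j : ℕ) : R) * A i j).det := by
    intro i
    have h1 : (Matrix.of fun a j : Fin k => (descPochhammer R j).eval
        ((x - Pi.single i 1 : Fin k → R) a)) =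
        A.updateRow i fun j => (descPochhammer R j).eval (x i - 1) := by
      ext a j
      by_cases h : a = i
      · subst h; simp
      · simp [h, hA]
    rw [key, h1, ← Matrix.det_updateRow_smul, eq_sub_iff_add_eq, ← Matrix.det_updateRow_add]
    have h2 : (x i • (fun j : Fin k => (descPochhammer R j).eval (x i - 1)) +
        fun j : Fin k => ((j : ℕ) : R) * A i j) = x i • A i := by
      ext j
      have h3 : x i * (descPochhammer R j).eval (x i - 1) =
          (descPochhammer R j).eval (x i) * (x i - (j : ℕ)) := by
        rw [← descPochhammer_succ_eval, descPochhammer_succ_left]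
        simp
      simp only [Pi.add_apply, Pi.smul_apply, smul_eq_mul, h3, hA, Matrix.of_apply]
      ring
    rw [h2, Matrix.det_updateRow_smul, Matrix.updateRow_eq_self]
  simp_rw [row, Finset.sum_sub_distrib, sum_det_updateRow_mul, key x]
  rw [← Finset.sum_mul]
  ring

theorem det_vandermonde_const_sub {R : Type*} [CommRing R] {k : ℕ} (c : R) (x : Fin k → R) :
    (Matrix.vandermonde fun i => c - x i).det =
      (∏ i : Fin k, ∏ _j ∈ Finset.Ioi i, (-1)) * (Matrix.vandermonde x).det := by
  simp_rw [Matrix.det_vandermonde, ← Finset.prod_mul_distrib]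
  exact Finset.prod_congr rfl fun i _ => Finset.prod_congr rfl fun j _ => by ring

theorem sum_mul_det_vandermonde_add_single {R : Type*} [CommRing R] [IsDomain R] {k : ℕ}
    (β : R) (x : Fin k → R) :
    ∑ i, (β + x i) * (Matrix.vandermonde (x + Pi.single i 1)).det =
      (k * β + ∑ i, x i + ∑ i : Fin k, ((i : ℕ) : R)) * (Matrix.vandermonde x).det := by
  have h := sum_mul_det_vandermonde_sub_single fun i => -β - x i
  have e : ∀ i : Fin k, (fun i => -β - x i) - Pi.single i 1 =
      fun a => -β - (x + Pi.single i 1 : Fin k → R) a := by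
    intro i; ext a; simp only [Pi.sub_apply, Pi.add_apply]; ring
  have hε : IsUnit (∏ i : Fin k, ∏ _j ∈ Finset.Ioi i, (-1 : R)) := by
    simp [IsUnit.prod_iff, isUnit_one.neg.pow]
  simp_rw [e, det_vandermonde_const_sub] at h
  apply hε.mul_left_cancel
  rw [Finset.mul_sum, ← neg_inj, ← Finset.sum_neg_distrib]
  rw [Finset.sum_sub_distrib] at h
  simp only [Finset.sum_const, Finset.card_univ, Fintype.card_fin, nsmul_eq_mul] at h
  refine Eq.trans (Finset.sum_congr rfl fun i _ => by ring) (h.trans ?_)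
  ring

/-- The unnormalised Meixner weight `(β)_l / l!`. -/
noncomputable def meixnerWeight (β : ℂ) (l : ℕ) : ℂ :=
  (∏ i ∈ Finset.range l, (β + i)) / (l.factorial : ℂ)

theorem meixnerWeight_succ (β : ℂ) (l : ℕ) :
    ((l : ℂ) + 1) * meixnerWeight β (l + 1) = (β + l) * meixnerWeight β l := by
  have h : ((l : ℂ) + 1) ≠ 0 := Nat.cast_add_one_ne_zero l
  have h' : (l.factorial : ℂ) ≠ 0 := by exact_mod_cast l.factorial_ne_zero
  rw [meixnerWeight, meixnerWeight, Finset.prod_range_succ, Nat.factorial_succ]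
  push_cast
  field_simp

theorem prod_meixnerWeight_add_single {k : ℕ} (β : ℂ) (l : Fin k → ℕ) (i : Fin k) :
    ((l i : ℂ) + 1) * ∏ j, meixnerWeight β ((l + Pi.single i 1 : Fin k → ℕ) j) =
      (β + l i) * ∏ j, meixnerWeight β (l j) := by
  rw [← Finset.mul_prod_erase _ _ (Finset.mem_univ i),
    ← Finset.mul_prod_erase _ (fun j => meixnerWeight β (l j)) (Finset.mem_univ i),
    ← mul_assoc, ← mul_assoc]
  congr 1
  · simpa using meixnerWeight_succ β (l i)
  · refine Finset.prod_congr rfl fun j hj => ?_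
    simp [Finset.ne_of_mem_erase hj]

theorem sum_piAntidiag_succ_eq {ι R : Type*} [Fintype ι] [DecidableEq ι] [AddCommMonoid R] (M : ℕ)
    (i : ι) (F : (ι → ℕ) → R) (hF : ∀ l, l i = 0 → F l = 0) :
    ∑ l ∈ Finset.piAntidiag Finset.univ (M + 1), F l =
      ∑ l ∈ Finset.piAntidiag Finset.univ M, F (l + Pi.single i 1) := by
  symm
  refine Finset.sum_of_injOn (fun l => l + Pi.single i 1)
    (fun a _ b _ h => add_right_cancel h) ?_ ?_ fun _ _ => rfl
  · intro l hl
    simp only [Finset.mem_coe, Finset.mem_piAntidiag] at hl ⊢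
    simp_all [Finset.sum_add_distrib]
  · intro l hl hl'
    refine hF l (by_contra fun h0 => hl' ⟨l - Pi.single i 1, ?_, ?_⟩)
    · have hle : Pi.single i 1 ≤ l := by
        intro j
        by_cases hj : j = i
        · subst hj; simp; omega
        · simp [hj]
      simp only [Finset.mem_coe, Finset.mem_piAntidiag, Finset.mem_univ, implies_true,
        and_true] at hl ⊢
      have : ∑ j, ((l - Pi.single i 1 : ι → ℕ) + Pi.single i 1 : ι → ℕ) j = M + 1 := by
        rw [tsub_add_cancel_of_le hle]; exact hl
      simpa [Finset.sum_add_distrib] using this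
    · ext j
      by_cases hj : j = i
      · subst hj; simp; omega
      · simp [hj]

/-- The sum of `Δ(l)² ∏ (β)_{lᵢ} / lᵢ!` over `l : Fin k → ℕ` with total `M`. -/
noncomputable def meixnerSum (k : ℕ) (β : ℂ) (M : ℕ) : ℂ :=
  ∑ l ∈ Finset.piAntidiag (Finset.univ : Finset (Fin k)) M,
    (Matrix.vandermonde fun i => (l i : ℂ)).det ^ 2 * ∏ i, meixnerWeight β (l i)

theorem meixnerSum_succ (k : ℕ) (β : ℂ) (M : ℕ) :
    ((M : ℂ) + 1 - ∑ i : Fin k, ((i : ℕ) : ℂ)) * meixnerSum k β (M + 1) =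
      (k * β + M + ∑ i : Fin k, ((i : ℕ) : ℂ)) * meixnerSum k β M := by
  have sum_cast : ∀ N : ℕ, ∀ l ∈ Finset.piAntidiag (Finset.univ : Finset (Fin k)) N,
      ∑ i, (l i : ℂ) = (N : ℂ) := by
    intro N l hl
    rw [← (Finset.mem_piAntidiag.1 hl).1]
    push_cast
    rfl
  calc
    _ = ∑ l ∈ Finset.piAntidiag (Finset.univ : Finset (Fin k)) (M + 1), ∑ i, (l i : ℂ) *
          (Matrix.vandermonde ((fun i => (l i : ℂ)) - Pi.single i 1)).det *
          ((Matrix.vandermonde fun i => (l i : ℂ)).det * ∏ i, meixnerWeight β (l i)) := by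
      rw [meixnerSum, Finset.mul_sum]
      refine Finset.sum_congr rfl fun l hl => ?_
      rw [← Finset.sum_mul, sum_mul_det_vandermonde_sub_single, sum_cast _ l hl]
      push_cast
      ring
    _ = ∑ l ∈ Finset.piAntidiag (Finset.univ : Finset (Fin k)) M, ∑ i, (β + l i) *
          (Matrix.vandermonde ((fun i => (l i : ℂ)) + Pi.single i 1)).det *
          ((Matrix.vandermonde fun i => (l i : ℂ)).det * ∏ i, meixnerWeight β (l i)) := by
      rw [Finset.sum_comm, Finset.sum_comm (s := Finset.piAntidiag _ _)]
      refine Finset.sum_congr rfl fun i _ => ?_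
      rw [sum_piAntidiag_succ_eq M i _ fun l hl => by simp [hl]]
      refine Finset.sum_congr rfl fun l _ => ?_
      have e : (fun j => (((l + Pi.single i 1 : Fin k → ℕ) j : ℕ) : ℂ)) =
          (fun j => (l j : ℂ)) + Pi.single i 1 := by
        ext j
        by_cases hj : j = i
        · subst hj; simp
        · simp [hj]
      have h := prod_meixnerWeight_add_single β l i
      rw [e, add_sub_cancel_right]
      simp only [Pi.add_apply, Pi.single_eq_same] at h ⊢
      push_cast
      linear_combination (Matrix.vandermonde fun i => (l i : ℂ)).det *
        (Matrix.vandermonde ((fun i => (l i : ℂ)) + Pi.single i 1)).det * h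
    _ = _ := by
      rw [meixnerSum, Finset.mul_sum]
      refine Finset.sum_congr rfl fun l hl => ?_
      rw [← Finset.sum_mul, sum_mul_det_vandermonde_add_single, sum_cast _ l hl]
      ring

/-- The distance between two natural numbers, with the convention that it is `1` on the
diagonal. -/
def offDiagDist (a b : ℕ) : ℕ := if a = b then 1 else (a - b) + (b - a)

theorem offDiagDist_self (a : ℕ) : offDiagDist a a = 1 := by simp [offDiagDist]

theorem offDiagDist_comm (a b : ℕ) : offDiagDist a b = offDiagDist b a := by
  unfold offDiagDist; split_ifs <;> omega

theorem offDiagDist_pos (a b : ℕ) : 0 < offDiagDist a b := by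
  unfold offDiagDist; split_ifs <;> omega

theorem offDiagDist_sq {a b : ℕ} (h : a ≠ b) :
    (offDiagDist a b : ℂ) ^ 2 = ((a : ℂ) - b) ^ 2 := by
  rw [offDiagDist, if_neg h]
  rcases le_total a b with hab | hab
  · rw [Nat.sub_eq_zero_of_le hab, zero_add, Nat.cast_sub hab]; ring
  · rw [Nat.sub_eq_zero_of_le hab, add_zero, Nat.cast_sub hab]

/-- The product of `offDiagDist a b` over `a ∈ A` and `b ∈ B`. -/
def distProd (A B : Finset ℕ) : ℕ := ∏ a ∈ A, ∏ b ∈ B, offDiagDist a b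

theorem prod_Ioi_sq_eq_prod_offDiagDist {n : ℕ} (l : Fin n → ℕ) (hl : Function.Injective l) :
    ∏ i, ∏ j ∈ Finset.Ioi i, ((l i : ℂ) - l j) ^ 2 = ∏ i, ∏ j, (offDiagDist (l i) (l j) : ℂ) := by
  have h := Finset.prod_prod_Ioi_mul_eq_prod_prod_off_diag
    fun i j => (offDiagDist (l i) (l j) : ℂ)
  have h1 : ∀ i, ∏ j ∈ {i}ᶜ, (offDiagDist (l j) (l i) : ℂ) =
      ∏ j, (offDiagDist (l i) (l j) : ℂ) := by
    intro i
    rw [Fintype.prod_eq_mul_prod_compl i, offDiagDist_self, Nat.cast_one, one_mul]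
    exact Finset.prod_congr rfl fun j _ => by rw [offDiagDist_comm]
  simp_rw [← h1, ← h]
  refine Finset.prod_congr rfl fun i _ => Finset.prod_congr rfl fun j hj => ?_
  rw [offDiagDist_comm (l j), ← sq, offDiagDist_sq (hl.ne (Finset.mem_Ioi.1 hj).ne)]

theorem prod_offDiagDist_eq_distProd {n : ℕ} (l : Fin n → ℕ) (hl : Function.Injective l) :
    ∏ i, ∏ j, (offDiagDist (l i) (l j) : ℂ) =
      distProd (Finset.univ.image l) (Finset.univ.image l) := by
  rw [distProd]
  push_cast
  simp_rw [Finset.prod_image hl.injOn]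

/-- The weight of a point configuration in the Meixner ensemble. -/
noncomputable def ensembleWeight (β : ℂ) (S : Finset ℕ) : ℂ :=
  distProd S S * ∏ l ∈ S, meixnerWeight β l

theorem card_filter_image_eq {k M : ℕ} (S : Finset ℕ) (hS : S.card = k) (hM : ∑ a ∈ S, a = M) :
    ((Finset.piAntidiag (Finset.univ : Finset (Fin k)) M).filter fun l =>
      Function.Injective l ∧ Finset.univ.image l = S).card = k.factorial := by
  let e := S.orderEmbOfFin hS
  have he : Set.range e = S := S.range_orderEmbOfFin hS
  have : ((Finset.piAntidiag (Finset.univ : Finset (Fin k)) M).filter fun l =>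
      Function.Injective l ∧ Finset.univ.image l = S) =
      (Finset.univ : Finset (Equiv.Perm (Fin k))).image fun σ : Equiv.Perm (Fin k) =>
        (e ∘ σ : Fin k → ℕ) := by
    ext l
    simp only [Finset.mem_filter, Finset.mem_piAntidiag, Finset.mem_univ, implies_true, and_true,
      Finset.mem_image, true_and]
    constructor
    · rintro ⟨-, hl, hlS⟩
      have hmem : ∀ i, ∃ j, e j = l i := by
        intro i
        have : l i ∈ (S : Set ℕ) := by
          rw [← hlS]; simp
        rwa [← he] at this
      choose f hf using hmem
      have hfi : Function.Injective f := fun a b hab => hl (by rw [← hf, ← hf, hab])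
      exact ⟨Equiv.ofBijective f (Finite.injective_iff_bijective.1 hfi), funext hf⟩
    · rintro ⟨σ, rfl⟩
      have hinj : Function.Injective (e ∘ σ) := e.injective.comp σ.injective
      have him : Finset.univ.image (e ∘ σ) = S := by
        apply Finset.coe_injective
        rw [Finset.coe_image, Finset.coe_univ, Set.image_univ, Set.range_comp,
          σ.surjective.range_eq, Set.image_univ, he]
      refine ⟨?_, hinj, him⟩
      rw [← hM, ← him, Finset.sum_image hinj.injOn]
  rw [this, Finset.card_image_of_injective, Finset.card_univ, Fintype.card_perm, Fintype.card_fin]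
  intro σ τ h
  ext i
  exact congrArg Fin.val (e.injective (congrFun h i))

/-- The `k`-element sets of natural numbers with sum `M`. -/
def setsWithSum (k M : ℕ) : Finset (Finset ℕ) :=
  ((Finset.range (M + 1)).powersetCard k).filter fun S => ∑ a ∈ S, a = M

theorem mem_setsWithSum {k M : ℕ} {S : Finset ℕ} :
    S ∈ setsWithSum k M ↔ S.card = k ∧ ∑ a ∈ S, a = M := by
  simp only [setsWithSum, Finset.mem_filter, Finset.mem_powersetCard]
  refine ⟨fun h => ⟨h.1.2, h.2⟩, fun h => ⟨⟨fun a ha => ?_, h.1⟩, h.2⟩⟩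
  have := Finset.single_le_sum (f := fun a : ℕ => a) (fun _ _ => Nat.zero_le _) ha
  simp only [h.2] at this
  simpa using Nat.lt_succ_of_le this

theorem meixnerSum_eq_sum_setsWithSum (k : ℕ) (β : ℂ) (M : ℕ) :
    meixnerSum k β M = k.factorial * ∑ S ∈ setsWithSum k M, ensembleWeight β S := by
  classical
  have h0 : meixnerSum k β M = ∑ l ∈ (Finset.piAntidiag (Finset.univ : Finset (Fin k)) M).filter
      (fun l => Function.Injective l), ensembleWeight β (Finset.univ.image l) := by
    rw [meixnerSum, Finset.sum_filter]
    refine Finset.sum_congr rfl fun l _ => ?_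
    split_ifs with hl
    · rw [ensembleWeight, ← prod_offDiagDist_eq_distProd l hl,
      ← prod_Ioi_sq_eq_prod_offDiagDist l hl,
        Finset.prod_image hl.injOn, Matrix.det_vandermonde]
      simp_rw [← Finset.prod_pow]
      congr 1
      exact Finset.prod_congr rfl fun i _ => Finset.prod_congr rfl fun j _ => by ring
    · have : (Matrix.vandermonde fun i => (l i : ℂ)).det = 0 := by
        by_contra h
        exact hl (Nat.cast_injective.of_comp_iff (f := ((↑) : ℕ → ℂ)) l |>.1
          (Matrix.det_vandermonde_ne_zero_iff.1 h))
      simp [this]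
  rw [h0, ← Finset.sum_fiberwise_of_maps_to (t := setsWithSum k M)
    (g := fun l => Finset.univ.image l), Finset.mul_sum]
  · refine Finset.sum_congr rfl fun S hS => ?_
    rw [mem_setsWithSum] at hS
    rw [Finset.filter_filter, ← card_filter_image_eq S hS.1 hS.2, ← nsmul_eq_mul]
    refine Finset.sum_eq_card_nsmul fun l hl => ?_
    rw [(Finset.mem_filter.1 hl).2.2]
  · intro l hl
    obtain ⟨hl, hinj⟩ := Finset.mem_filter.1 hl
    rw [mem_setsWithSum, Finset.card_image_of_injective _ hinj, Finset.sum_image hinj.injOn]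
    exact ⟨by simp, (Finset.mem_piAntidiag.1 hl).1⟩

theorem distProd_comm (A B : Finset ℕ) : distProd A B = distProd B A := by
  rw [distProd, distProd, Finset.prod_comm]
  simp_rw [offDiagDist_comm]

theorem distProd_union_left {A B : Finset ℕ} (h : Disjoint A B) (C : Finset ℕ) :
    distProd (A ∪ B) C = distProd A C * distProd B C :=
  Finset.prod_union h

theorem distProd_union_right {A B : Finset ℕ} (h : Disjoint A B) (C : Finset ℕ) :
    distProd C (A ∪ B) = distProd C A * distProd C B := by
  rw [distProd_comm, distProd_union_left h, distProd_comm A, distProd_comm B]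

theorem distProd_union_self {A B : Finset ℕ} (h : Disjoint A B) :
    distProd (A ∪ B) (A ∪ B) = distProd A A * distProd A B ^ 2 * distProd B B := by
  rw [distProd_union_left h, distProd_union_right h, distProd_union_right h, distProd_comm B A]
  ring

theorem distProd_pos (A B : Finset ℕ) : 0 < distProd A B :=
  Finset.prod_pos fun _ _ => Finset.prod_pos fun _ _ => offDiagDist_pos _ _

theorem prod_range_offDiagDist_add (k p : ℕ) :
    (∏ a ∈ Finset.range k, offDiagDist a (k + p)) * p.factorial = (k + p).factorial := by
  induction k generalizing p with
  | zero => simp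
  | succ k ih =>
    have h : offDiagDist k (k + 1 + p) = p + 1 := by unfold offDiagDist; split_ifs <;> omega
    rw [Finset.prod_range_succ, h, mul_assoc, ← Nat.factorial_succ,
      show k + 1 + p = k + (p + 1) by ring, ih]

theorem prod_range_offDiagDist_sub {k h : ℕ} (hk : h < k) :
    ∏ a ∈ Finset.range k, offDiagDist a (k - 1 - h) = h.factorial * (k - 1 - h).factorial := by
  obtain ⟨m, rfl⟩ : ∃ m, k = m + 1 + h := ⟨k - 1 - h, by omega⟩
  have e : m + 1 + h - 1 - h = m := by omega
  rw [e]
  clear e hk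
  induction h with
  | zero =>
    have := prod_range_offDiagDist_add m 0
    rw [Finset.prod_range_succ, offDiagDist_self]
    simpa using this
  | succ h ih =>
    have h' : offDiagDist (m + 1 + h) m = h + 1 := by unfold offDiagDist; split_ifs <;> omega
    rw [← add_assoc, Finset.prod_range_succ, ih, h', Nat.factorial_succ]
    ring

/-- The contribution of a particle to the product of shifted contents. -/
noncomputable def particleFactor (ν : ℂ) (p : ℕ) : ℂ := ∏ i ∈ Finset.range p, (ν + 1 + i)

/-- The contribution of a hole to the product of shifted contents. -/
noncomputable def holeFactor (ν : ℂ) (h : ℕ) : ℂ := ∏ i ∈ Finset.range (h + 1), (ν - i)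

/-- The product of shifted contents of a particle–hole configuration. -/
noncomputable def contentProd (ν : ℂ) (P H : Finset ℕ) : ℂ :=
  (∏ p ∈ P, particleFactor ν p) * ∏ h ∈ H, holeFactor ν h

/-- The squared inverse hook product of a particle–hole configuration. -/
noncomputable def hookWeight (P H : Finset ℕ) : ℂ :=
  (distProd P P : ℂ) * distProd H H / (∏ h ∈ H, ∏ p ∈ P, ((h : ℂ) + p + 1)) ^ 2 /
    ((∏ p ∈ P, (p.factorial : ℂ) ^ 2) * ∏ h ∈ H, (h.factorial : ℂ) ^ 2)

/-- The `k`-point configuration obtained from the ground state `{0, …, k - 1}` by emptying the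
positions `k - 1 - h` and filling the positions `k + p`. -/
def maya (k : ℕ) (P H : Finset ℕ) : Finset ℕ :=
  (Finset.range k \ H.image fun h => k - 1 - h) ∪ P.image fun p => k + p

theorem injOn_sub_of_subset_range {k : ℕ} {H : Finset ℕ} (hH : H ⊆ Finset.range k) :
    Set.InjOn (fun h => k - 1 - h) (H : Set ℕ) := by
  intro a ha b hb hab
  have := Finset.mem_range.1 (hH ha)
  have := Finset.mem_range.1 (hH hb)
  simp only at hab
  omega

theorem image_sub_subset_range {k : ℕ} {H : Finset ℕ} (hH : H ⊆ Finset.range k) :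
    (H.image fun h => k - 1 - h) ⊆ Finset.range k := by
  intro a ha
  obtain ⟨h, hh, rfl⟩ := Finset.mem_image.1 ha
  have := Finset.mem_range.1 (hH hh)
  simp only [Finset.mem_range]
  omega

theorem disjoint_range_sdiff_image_add (k : ℕ) (P A : Finset ℕ) :
    Disjoint (Finset.range k \ A) (P.image fun p => k + p) := by
  rw [Finset.disjoint_left]
  intro a ha ha'
  obtain ⟨p, -, rfl⟩ := Finset.mem_image.1 ha'
  simp at ha

theorem meixnerWeight_particle {k : ℕ} (μ : ℂ) (p : ℕ) :
    ((∏ a ∈ Finset.range k, offDiagDist a (k + p) : ℕ) : ℂ) ^ 2 *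
        meixnerWeight (μ - k + 1) (k + p) =
      (k.factorial * ∏ i ∈ Finset.range k, (μ - k + 1 + i)) *
        (particleFactor k p * particleFactor μ p / (p.factorial : ℂ) ^ 2) := by
  have h1 : ((∏ a ∈ Finset.range k, offDiagDist a (k + p) : ℕ) : ℂ) * p.factorial =
      (k + p).factorial := by
    exact_mod_cast prod_range_offDiagDist_add k p
  have h2 : (k.factorial : ℂ) * particleFactor k p = (k + p).factorial := by
    rw [particleFactor]
    induction p with
    | zero => simp
    | succ p ih =>
      rw [Finset.prod_range_succ, ← mul_assoc,
        ih (by exact_mod_cast prod_range_offDiagDist_add k p),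
        ← add_assoc, Nat.factorial_succ]
      push_cast
      ring
  have h3 : ∏ i ∈ Finset.range (k + p), (μ - k + 1 + i) =
      (∏ i ∈ Finset.range k, (μ - k + 1 + i)) * particleFactor μ p := by
    rw [Finset.prod_range_add, particleFactor]
    congr 1
    refine Finset.prod_congr rfl fun i _ => ?_
    push_cast
    ring
  have hp : (p.factorial : ℂ) ≠ 0 := by exact_mod_cast p.factorial_ne_zero
  have hkp : ((k + p).factorial : ℂ) ≠ 0 := by exact_mod_cast (k + p).factorial_ne_zero
  rw [eq_div_of_mul_eq hp h1, meixnerWeight, h3]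
  field_simp
  linear_combination
    -((∏ i ∈ Finset.range k, (μ - k + 1 + i)) * particleFactor μ p) * h2

theorem meixnerWeight_hole {k h : ℕ} (hk : h < k) (μ : ℂ) :
    (k.factorial * ∏ i ∈ Finset.range k, (μ - k + 1 + i)) =
      (holeFactor k h * holeFactor μ h / (h.factorial : ℂ) ^ 2) *
      (((∏ a ∈ Finset.range k, offDiagDist a (k - 1 - h) : ℕ) : ℂ) ^ 2 *
        meixnerWeight (μ - k + 1) (k - 1 - h)) := by
  rw [prod_range_offDiagDist_sub hk, meixnerWeight]
  obtain ⟨m, rfl⟩ : ∃ m, k = m + 1 + h := ⟨k - 1 - h, by omega⟩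
  have e : m + 1 + h - 1 - h = m := by omega
  rw [e]
  have h2 : ((m + 1 + h).factorial : ℂ) = holeFactor ((m + 1 + h : ℕ) : ℂ) h * m.factorial := by
    clear e hk
    induction h generalizing m with
    | zero =>
      simp [holeFactor, Nat.factorial_succ]
    | succ h ih =>
      have := ih (m + 1)
      rw [show m + 1 + (h + 1) = m + 1 + 1 + h by ring, this, holeFactor, holeFactor,
        Finset.prod_range_succ _ (h + 1), Nat.factorial_succ]
      push_cast
      ring
  have h3 : ∏ i ∈ Finset.range (m + 1 + h), (μ - (m + 1 + h : ℕ) + 1 + i) =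
      (∏ i ∈ Finset.range m, (μ - (m + 1 + h : ℕ) + 1 + i)) * holeFactor μ h := by
    rw [show m + 1 + h = m + (h + 1) by ring, Finset.prod_range_add, holeFactor,
      ← Finset.prod_range_reflect _ (h + 1)]
    congr 1
    refine Finset.prod_congr rfl fun i hi => ?_
    have hi' : i ≤ h := Nat.lt_succ_iff.1 (Finset.mem_range.1 hi)
    rw [show h + 1 - 1 - i = h - i by omega]
    push_cast [Nat.cast_sub hi']
    ring
  have hh : (h.factorial : ℂ) ≠ 0 := by exact_mod_cast h.factorial_ne_zero
  have hm : (m.factorial : ℂ) ≠ 0 := by exact_mod_cast m.factorial_ne_zero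
  rw [h3, h2]
  push_cast
  field_simp

theorem ensembleWeight_maya {k : ℕ} (μ : ℂ) (hμ : ∀ i < k, μ - k + 1 + i ≠ 0) {P H : Finset ℕ}
    (hH : H ⊆ Finset.range k) (hPH : P.card = H.card) :
    ensembleWeight (μ - k + 1) (maya k P H) = ensembleWeight (μ - k + 1) (Finset.range k) *
      (hookWeight P H * contentProd k P H * contentProd μ P H) := by
  set β := μ - k + 1 with hβ
  set H' := H.image fun h => k - 1 - h with hH'
  set P' := P.image fun p => k + p with hP'
  set C := Finset.range k \ H' with hC
  have hsub : H' ⊆ Finset.range k := image_sub_subset_range hH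
  have hinjH := injOn_sub_of_subset_range hH
  have hinjP : Set.InjOn (fun p => k + p) (P : Set ℕ) := fun a _ b _ h => add_left_cancel h
  have hCP : Disjoint C P' := disjoint_range_sdiff_image_add k P H'
  have hCH : Disjoint C H' := Finset.sdiff_disjoint
  have hR : Finset.range k = C ∪ H' := (Finset.sdiff_union_of_subset hsub).symm
  have hw : ∀ l < k, meixnerWeight β l ≠ 0 := by
    intro l hl
    refine div_ne_zero (Finset.prod_ne_zero_iff.2 fun i hi => hμ i ?_)
      (by exact_mod_cast l.factorial_ne_zero)
    exact (Finset.mem_range.1 hi).trans hl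
  have hPP : distProd P' P' = distProd P P := by
    simp only [distProd, hP']
    rw [Finset.prod_image hinjP]
    refine Finset.prod_congr rfl fun a _ => ?_
    rw [Finset.prod_image hinjP]
    refine Finset.prod_congr rfl fun b _ => ?_
    unfold offDiagDist; split_ifs <;> omega
  have hHH : distProd H' H' = distProd H H := by
    simp only [distProd, hH']
    rw [Finset.prod_image hinjH]
    refine Finset.prod_congr rfl fun a ha => ?_
    rw [Finset.prod_image hinjH]
    refine Finset.prod_congr rfl fun b hb => ?_
    have := Finset.mem_range.1 (hH ha)
    have := Finset.mem_range.1 (hH hb)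
    unfold offDiagDist; split_ifs <;> omega
  have hHP : (distProd H' P' : ℂ) = ∏ h ∈ H, ∏ p ∈ P, ((h : ℂ) + p + 1) := by
    simp only [distProd, hH', hP']
    rw [Finset.prod_image hinjH]
    push_cast
    refine Finset.prod_congr rfl fun a ha => ?_
    rw [Finset.prod_image hinjP]
    refine Finset.prod_congr rfl fun b _ => ?_
    have := Finset.mem_range.1 (hH ha)
    have : offDiagDist (k - 1 - a) (k + b) = a + b + 1 := by
      unfold offDiagDist; split_ifs <;> omega
    rw [this]
    push_cast
    rfl
  set G : ℂ := k.factorial * ∏ i ∈ Finset.range k, (β + i) with hG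
  have hG0 : G ≠ 0 := mul_ne_zero (by exact_mod_cast k.factorial_ne_zero)
    (Finset.prod_ne_zero_iff.2 fun i hi => hμ i (Finset.mem_range.1 hi))
  have hRP : (distProd (Finset.range k) P' : ℂ) ^ 2 * ∏ l ∈ P', meixnerWeight β l =
      G ^ P.card * ∏ p ∈ P,
        (particleFactor k p * particleFactor μ p / (p.factorial : ℂ) ^ 2) := by
    rw [distProd_comm, distProd, hP', Finset.prod_image hinjP, Finset.prod_image hinjP,
      Nat.cast_prod, ← Finset.prod_pow, ← Finset.prod_mul_distrib, ← Finset.prod_const,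
      ← Finset.prod_mul_distrib]
    refine Finset.prod_congr rfl fun p _ => ?_
    simp_rw [offDiagDist_comm (k + p)]
    exact meixnerWeight_particle μ p
  have hRH : G ^ H.card = (∏ h ∈ H,
        (holeFactor k h * holeFactor μ h / (h.factorial : ℂ) ^ 2)) *
      ((distProd (Finset.range k) H' : ℂ) ^ 2 * ∏ l ∈ H', meixnerWeight β l) := by
    rw [distProd_comm, distProd, hH', Finset.prod_image hinjH, Finset.prod_image hinjH,
      Nat.cast_prod, ← Finset.prod_pow, ← Finset.prod_mul_distrib, ← Finset.prod_const,
      ← Finset.prod_mul_distrib]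
    refine Finset.prod_congr rfl fun h hh => ?_
    simp_rw [offDiagDist_comm (k - 1 - h)]
    exact meixnerWeight_hole (Finset.mem_range.1 (hH hh)) μ
  have pos : ∀ A B, (distProd A B : ℂ) ≠ 0 := fun A B => by
    exact_mod_cast (distProd_pos A B).ne'
  have hwH : ∏ l ∈ H', meixnerWeight β l ≠ 0 :=
    Finset.prod_ne_zero_iff.2 fun l hl => hw l (Finset.mem_range.1 (hsub hl))
  have content_eq : hookWeight P H * contentProd k P H * contentProd μ P H =
      (distProd P P : ℂ) * distProd H H / (distProd H' P' : ℂ) ^ 2 *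
      (∏ p ∈ P, (particleFactor k p * particleFactor μ p / (p.factorial : ℂ) ^ 2)) *
      ∏ h ∈ H, (holeFactor k h * holeFactor μ h / (h.factorial : ℂ) ^ 2) := by
    rw [hookWeight, contentProd, contentProd, hHP]
    simp only [Finset.prod_mul_distrib, Finset.prod_div_distrib]
    field_simp
  have eP : distProd (Finset.range k) P' = distProd C P' * distProd H' P' := by
    rw [hR, distProd_union_left hCH]
  have eH : distProd (Finset.range k) H' = distProd C H' * distProd H' H' := by
    rw [hR, distProd_union_left hCH]
  have eR : ensembleWeight β (Finset.range k) =
      distProd C C * distProd C H' ^ 2 * distProd H' H' *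
        ((∏ l ∈ C, meixnerWeight β l) * ∏ l ∈ H', meixnerWeight β l) := by
    rw [ensembleWeight, hR, distProd_union_self hCH, Finset.prod_union hCH]
    push_cast
    ring
  rw [content_eq, eR, maya, ensembleWeight, distProd_union_self hCP, Finset.prod_union hCP]
  rw [eP] at hRP
  rw [eH] at hRH
  rw [hPH, hRH] at hRP
  rw [← hPP, ← hHH]
  push_cast at hRP ⊢
  have n1 := pos H' P'
  have n2 := pos C P'
  field_simp
  linear_combination ((distProd C C : ℂ) * distProd P' P' * (∏ l ∈ C, meixnerWeight β l)) * hRP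

/-- The momentum of a particle–hole configuration given by its sets of particles and holes. -/
def momentum (P H : Finset ℕ) : ℕ := ∑ p ∈ P, p + ∑ h ∈ H, (h + 1)

/-- The balanced pairs of sets of particles and holes with momentum `N`. -/
def balancedPairs (N : ℕ) : Finset (Finset ℕ × Finset ℕ) :=
  ((Finset.range (N + 1)).powerset ×ˢ (Finset.range (N + 1)).powerset).filter
    fun x => x.1.card = x.2.card ∧ momentum x.1 x.2 = N

theorem mem_balancedPairs {N : ℕ} {x : Finset ℕ × Finset ℕ} :
    x ∈ balancedPairs N ↔ x.1.card = x.2.card ∧ momentum x.1 x.2 = N := by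
  simp only [balancedPairs, Finset.mem_filter, Finset.mem_product, Finset.mem_powerset]
  refine ⟨fun h => h.2, fun h => ⟨⟨fun a ha => ?_, fun a ha => ?_⟩, h⟩⟩
  · have := Finset.single_le_sum (f := fun p : ℕ => p) (fun _ _ => Nat.zero_le _) ha
    have := h.2
    simp only [momentum, Finset.mem_range] at *
    omega
  · have := Finset.single_le_sum (f := fun p : ℕ => p + 1) (fun _ _ => Nat.zero_le _) ha
    have := h.2
    simp only [momentum, Finset.mem_range] at *
    omega

theorem card_maya {k : ℕ} {P H : Finset ℕ} (hH : H ⊆ Finset.range k) (hPH : P.card = H.card) :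
    (maya k P H).card = k := by
  have h1 := Finset.card_image_of_injOn (injOn_sub_of_subset_range hH)
  have h2 := Finset.card_le_card hH
  rw [maya, Finset.card_union_of_disjoint (disjoint_range_sdiff_image_add _ _ _),
    Finset.card_sdiff_of_subset (image_sub_subset_range hH), h1,
    Finset.card_image_of_injective _ (add_right_injective k), hPH]
  rw [Finset.card_range] at *
  omega

theorem sum_maya {k : ℕ} {P H : Finset ℕ} (hH : H ⊆ Finset.range k) (hPH : P.card = H.card) :
    ∑ a ∈ maya k P H, a = momentum P H + ∑ i ∈ Finset.range k, i := by
  have h1 := Finset.sum_sdiff (f := fun a : ℕ => a) (image_sub_subset_range hH)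
  have h2 : ∑ a ∈ H, (k - 1 - a) + ∑ a ∈ H, (a + 1) = H.card * k := by
    rw [← Finset.sum_add_distrib]
    refine Finset.sum_const_nat fun a ha => ?_
    have := Finset.mem_range.1 (hH ha)
    omega
  rw [Finset.sum_image (injOn_sub_of_subset_range hH)] at h1
  rw [maya, Finset.sum_union (disjoint_range_sdiff_image_add _ _ _),
    Finset.sum_image (add_right_injective k).injOn, Finset.sum_add_distrib, Finset.sum_const,
    smul_eq_mul, hPH, momentum]
  omega

theorem image_sub_image_sub_of_subset_range {k : ℕ} {A : Finset ℕ} (hA : A ⊆ Finset.range k) :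
    ((A.image fun a => k - 1 - a).image fun a => k - 1 - a) = A := by
  rw [Finset.image_image]
  refine (Finset.image_congr fun a ha => ?_).trans Finset.image_id
  have := Finset.mem_range.1 (hA ha)
  simp only [Function.comp_apply, id]
  omega

/-- The particles of a `k`-point configuration relative to the ground state `{0, …, k - 1}`. -/
def particlesOf (k : ℕ) (S : Finset ℕ) : Finset ℕ :=
  (S.filter fun a => k ≤ a).image fun a => a - k

/-- The holes of a `k`-point configuration relative to the ground state `{0, …, k - 1}`. -/
def holesOf (k : ℕ) (S : Finset ℕ) : Finset ℕ :=
  (Finset.range k \ S).image fun a => k - 1 - a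

theorem holesOf_subset_range (k : ℕ) (S : Finset ℕ) : holesOf k S ⊆ Finset.range k :=
  image_sub_subset_range Finset.sdiff_subset

theorem maya_particlesOf_holesOf (k : ℕ) (S : Finset ℕ) :
    maya k (particlesOf k S) (holesOf k S) = S := by
  have hP : (particlesOf k S).image (fun p => k + p) = S.filter fun a => k ≤ a := by
    rw [particlesOf, Finset.image_image]
    refine (Finset.image_congr fun a ha => ?_).trans Finset.image_id
    have := (Finset.mem_filter.1 ha).2
    simp only [Function.comp_apply, id]
    omega
  rw [maya, hP, holesOf, image_sub_image_sub_of_subset_range Finset.sdiff_subset]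
  ext a
  simp only [Finset.mem_union, Finset.mem_sdiff, Finset.mem_range, Finset.mem_filter]
  grind

theorem card_particlesOf_eq_card_holesOf {k : ℕ} {S : Finset ℕ} (hS : S.card = k) :
    (particlesOf k S).card = (holesOf k S).card := by
  have h1 : (particlesOf k S).card = (S.filter fun a => k ≤ a).card := by
    refine Finset.card_image_of_injOn fun a ha b hb hab => ?_
    have := (Finset.mem_filter.1 ha).2
    have := (Finset.mem_filter.1 hb).2
    have : a - k = b - k := hab
    omega
  have h2 : (S.filter fun a => k ≤ a) = S \ Finset.range k := by
    ext a; simp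
  rw [h1, h2, holesOf, Finset.card_image_of_injOn (injOn_sub_of_subset_range Finset.sdiff_subset)]
  exact Finset.card_sdiff_comm (by rw [hS, Finset.card_range])

theorem particlesOf_maya (k : ℕ) (P H : Finset ℕ) : particlesOf k (maya k P H) = P := by
  have h : ((maya k P H).filter fun a => k ≤ a) = P.image fun p => k + p := by
    ext a
    simp only [maya, Finset.mem_filter, Finset.mem_union, Finset.mem_sdiff, Finset.mem_range,
      Finset.mem_image]
    grind
  rw [particlesOf, h, Finset.image_image]
  exact (Finset.image_congr fun a _ => by simp).trans Finset.image_id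

theorem holesOf_maya {k : ℕ} (P : Finset ℕ) {H : Finset ℕ} (hH : H ⊆ Finset.range k) :
    holesOf k (maya k P H) = H := by
  have hsub := image_sub_subset_range hH
  have h : Finset.range k \ maya k P H = H.image fun h => k - 1 - h := by
    ext a
    have := @hsub a
    simp only [maya, Finset.mem_union, Finset.mem_sdiff, Finset.mem_range,
      Finset.mem_image] at this ⊢
    grind
  rw [holesOf, h, image_sub_image_sub_of_subset_range hH]

theorem holeFactor_natCast_eq_zero {k h : ℕ} (hk : k ≤ h) : holeFactor k h = 0 :=
  Finset.prod_eq_zero (Finset.mem_range.2 (Nat.lt_succ_of_le hk)) (sub_self _)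

/-- The sum of `∏ (ν + c) (μ + c) / H²` over balanced configurations of momentum `N`. -/
noncomputable def contentSum (N : ℕ) (ν μ : ℂ) : ℂ :=
  ∑ x ∈ balancedPairs N, hookWeight x.1 x.2 * contentProd ν x.1 x.2 * contentProd μ x.1 x.2

theorem sum_ensembleWeight {k : ℕ} (N : ℕ) (μ : ℂ) (hμ : ∀ i < k, μ - k + 1 + i ≠ 0) :
    ∑ S ∈ setsWithSum k (N + ∑ i ∈ Finset.range k, i), ensembleWeight (μ - k + 1) S =
      ensembleWeight (μ - k + 1) (Finset.range k) * contentSum N k μ := by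
  classical
  have h0 : contentSum N k μ = ∑ x ∈ (balancedPairs N).filter fun x => x.2 ⊆ Finset.range k,
      hookWeight x.1 x.2 * contentProd k x.1 x.2 * contentProd μ x.1 x.2 := by
    rw [contentSum, Finset.sum_filter_of_ne]
    intro x _ hx
    by_contra hsub
    obtain ⟨h, hh, hk⟩ := Finset.not_subset.1 hsub
    rw [Finset.mem_range, not_lt] at hk
    refine hx ?_
    rw [contentProd, Finset.prod_eq_zero (i := h) hh (holeFactor_natCast_eq_zero hk)]
    ring
  rw [h0, Finset.mul_sum]
  symm
  refine Finset.sum_nbij' (fun x => maya k x.1 x.2)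
    (fun S => (particlesOf k S, holesOf k S)) ?_ ?_ ?_ ?_ ?_
  · rintro ⟨P, H⟩ hx
    obtain ⟨hx, hH⟩ := Finset.mem_filter.1 hx
    obtain ⟨hc, hm⟩ := mem_balancedPairs.1 hx
    rw [mem_setsWithSum, ← hm]
    exact ⟨card_maya hH hc, sum_maya hH hc⟩
  · intro S hS
    obtain ⟨hc, hs⟩ := mem_setsWithSum.1 hS
    have hcard := card_particlesOf_eq_card_holesOf hc
    have hsum := sum_maya (holesOf_subset_range k S) hcard
    rw [maya_particlesOf_holesOf, hs] at hsum
    exact Finset.mem_filter.2 ⟨mem_balancedPairs.2 ⟨hcard, (add_right_cancel hsum).symm⟩,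
      holesOf_subset_range k S⟩
  · rintro ⟨P, H⟩ hx
    obtain ⟨hx, hH⟩ := Finset.mem_filter.1 hx
    exact Prod.ext (particlesOf_maya k P H) (holesOf_maya P hH)
  · exact fun S _ => maya_particlesOf_holesOf k S
  · rintro ⟨P, H⟩ hx
    obtain ⟨hx, hH⟩ := Finset.mem_filter.1 hx
    exact (ensembleWeight_maya μ hμ hH (mem_balancedPairs.1 hx).1).symm

theorem contentSum_succ_natCast (N k : ℕ) (μ : ℂ) (hμ : ∀ n : ℤ, μ ≠ n) :
    ((N : ℂ) + 1) * contentSum (N + 1) k μ = (k * μ + N) * contentSum N k μ := by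
  have hμ' : ∀ i : ℕ, μ - k + 1 + i ≠ 0 := fun i h => hμ (k - 1 - i) (by
    push_cast; linear_combination h)
  have hC : ∑ i : Fin k, ((i : ℕ) : ℂ) = ((∑ i ∈ Finset.range k, i : ℕ) : ℂ) := by
    rw [Nat.cast_sum, Fin.sum_univ_eq_sum_range (fun i => (i : ℂ))]
  have hC2 : ((∑ i ∈ Finset.range k, i : ℕ) : ℂ) * 2 = k * (k - 1) := by
    rcases k with _ | k
    · simp
    · have h := Finset.sum_range_id_mul_two (k + 1)
      rw [Nat.add_sub_cancel] at h
      rw [Nat.cast_succ, add_sub_cancel_right]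
      exact_mod_cast h
  have hW : ensembleWeight (μ - k + 1) (Finset.range k) ≠ 0 := by
    refine mul_ne_zero (by exact_mod_cast (distProd_pos _ _).ne')
      (Finset.prod_ne_zero_iff.2 fun l _ => ?_)
    exact div_ne_zero (Finset.prod_ne_zero_iff.2 fun i _ => hμ' i)
      (by exact_mod_cast l.factorial_ne_zero)
  have h := meixnerSum_succ k (μ - k + 1) (N + ∑ i ∈ Finset.range k, i)
  rw [add_right_comm, meixnerSum_eq_sum_setsWithSum, meixnerSum_eq_sum_setsWithSum,
    sum_ensembleWeight _ _ fun i _ => hμ' i, sum_ensembleWeight _ _ fun i _ => hμ' i, hC] at h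
  have hk : (k.factorial : ℂ) ≠ 0 := by exact_mod_cast k.factorial_ne_zero
  apply mul_left_cancel₀ (mul_ne_zero hk hW)
  generalize ∑ i ∈ Finset.range k, i = c at *
  push_cast at h
  linear_combination h + (k.factorial : ℂ) * ensembleWeight (μ - k + 1) (Finset.range k) *
    contentSum N k μ * hC2

open Polynomial in
theorem exists_polynomial_eval_eq_contentSum (N : ℕ) (μ : ℂ) :
    ∃ q : ℂ[X], ∀ ν, q.eval ν = contentSum N ν μ := by
  refine ⟨∑ x ∈ balancedPairs N, C (hookWeight x.1 x.2 * contentProd μ x.1 x.2) *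
    ((∏ p ∈ x.1, ∏ i ∈ Finset.range p, (X + 1 + C (i : ℂ))) *
      ∏ h ∈ x.2, ∏ i ∈ Finset.range (h + 1), (X - C (i : ℂ))), fun ν => ?_⟩
  simp only [contentSum, contentProd, particleFactor, holeFactor, eval_finsetSum, eval_mul, eval_C,
    eval_prod, eval_add, eval_sub, eval_X, eval_one]
  exact Finset.sum_congr rfl fun x _ => by ring

open Polynomial in
theorem contentSum_succ (N : ℕ) (ν μ : ℂ) (hμ : ∀ n : ℤ, μ ≠ n) :
    ((N : ℂ) + 1) * contentSum (N + 1) ν μ = (ν * μ + N) * contentSum N ν μ := by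
  obtain ⟨q, hq⟩ := exists_polynomial_eval_eq_contentSum N μ
  obtain ⟨r, hr⟩ := exists_polynomial_eval_eq_contentSum (N + 1) μ
  have h : C ((N : ℂ) + 1) * r = (X * C μ + C (N : ℂ)) * q := by
    refine eq_of_infinite_eval_eq _ _ ((Set.infinite_range_of_injective
      (Nat.cast_injective (R := ℂ))).mono ?_)
    rintro _ ⟨k, rfl⟩
    simpa [hq, hr, -X_mul_C] using contentSum_succ_natCast N k μ hμ
  simpa [hq, hr, -X_mul_C] using congrArg (eval ν) h

theorem contentSum_zero (ν μ : ℂ) : contentSum 0 ν μ = 1 := by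
  have : balancedPairs 0 = {(∅, ∅)} := by
    ext ⟨P, H⟩
    simp only [mem_balancedPairs, Finset.mem_singleton, Prod.mk.injEq]
    constructor
    · rintro ⟨hc, hm⟩
      have hH : H = ∅ := by
        by_contra hne
        obtain ⟨h, hh⟩ := Finset.nonempty_iff_ne_empty.2 hne
        simp only [momentum, add_eq_zero, Finset.sum_eq_zero_iff] at hm
        exact absurd (hm.2 h hh) (by simp)
      subst hH
      exact ⟨Finset.card_eq_zero.1 hc, rfl⟩
    · rintro ⟨rfl, rfl⟩
      simp [momentum]
  simp [contentSum, this, hookWeight, contentProd, distProd]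

theorem contentSum_eq_choose (N : ℕ) (ν μ : ℂ) (hμ : ∀ n : ℤ, μ ≠ n) :
    contentSum N ν μ = Ring.choose (-(ν * μ)) N * (-1) ^ N := by
  induction N with
  | zero => simp [contentSum_zero]
  | succ N ih =>
    have hN : ((N : ℂ) + 1) ≠ 0 := Nat.cast_add_one_ne_zero N
    have hf : (N.factorial : ℂ) ≠ 0 := by exact_mod_cast N.factorial_ne_zero
    apply mul_left_cancel₀ hN
    rw [contentSum_succ N ν μ hμ, ih, Ring.choose_eq_smul, Ring.choose_eq_smul,
      descPochhammer_succ_right, Polynomial.smeval_mul, Nat.factorial_succ]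
    simp only [Polynomial.smeval_sub, Polynomial.smeval_X, Polynomial.smeval_natCast, smul_eq_mul]
    push_cast
    field_simp
    simp
    ring

theorem hasSum_choose_mul_pow (a : ℂ) {z : ℂ} (hz : ‖z‖ < 1) :
    HasSum (fun N : ℕ => z ^ N * (Ring.choose (-a) N * (-1) ^ N)) ((1 - z) ^ (-a)) := by
  have h := (Complex.one_add_cpow_hasFPowerSeriesOnBall_zero (a := -a)).hasSum (y := -z)
    (by simpa [← ENNReal.ofReal_one, Metric.eball_ofReal] using hz)
  simp only [binomialSeries_apply, List.ofFn_const, List.prod_replicate, smul_eq_mul, zero_add] at h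
  have e : (fun N : ℕ => z ^ N * (Ring.choose (-a) N * (-1) ^ N)) =
      fun N => Ring.choose (-a) N * (-z) ^ N := by
    ext N
    rw [neg_pow z]
    ring
  rw [e, sub_eq_add_neg]
  exact h

theorem hookWeight_eq_norm (P H : Finset ℕ) : hookWeight P H = (‖hookWeight P H‖ : ℂ) := by
  have h : hookWeight P H = (((distProd P P : ℝ) * distProd H H /
      (∏ h ∈ H, ∏ p ∈ P, ((h : ℝ) + p + 1)) ^ 2 /
      ((∏ p ∈ P, (p.factorial : ℝ) ^ 2) * ∏ h ∈ H, (h.factorial : ℝ) ^ 2) : ℝ) : ℂ) := by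
    rw [hookWeight]
    push_cast
    rfl
  rw [h, Complex.norm_real, Real.norm_of_nonneg (by positivity)]

theorem contentProd_conj (ν : ℂ) (P H : Finset ℕ) :
    contentProd (starRingEnd ℂ ν) P H = starRingEnd ℂ (contentProd ν P H) := by
  simp [contentProd, particleFactor, holeFactor]

theorem norm_hookWeight_mul_contentProd_sq (ν : ℂ) (P H : Finset ℕ) :
    (‖hookWeight P H * contentProd ν P H * contentProd ν P H‖ : ℂ) =
      hookWeight P H * contentProd ν P H * contentProd (starRingEnd ℂ ν) P H := by
  rw [contentProd_conj, mul_assoc, mul_assoc, Complex.mul_conj', norm_mul, norm_mul]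
  push_cast
  rw [← hookWeight_eq_norm]
  ring

theorem Gamma_one_add_particle {ν : ℂ} (hν : ∀ n : ℤ, ν ≠ n) (p : ℕ) :
    Complex.Gamma (1 + (p : ℂ) + ν) = particleFactor ν p * Complex.Gamma (1 + ν) := by
  induction p with
  | zero => simp [particleFactor]
  | succ p ih =>
    have h : 1 + (p : ℂ) + ν ≠ 0 := fun h => hν (-1 - p) (by push_cast; linear_combination h)
    rw [show 1 + ((p + 1 : ℕ) : ℂ) + ν = 1 + (p : ℂ) + ν + 1 by push_cast; ring,
      Complex.Gamma_add_one _ h, ih, particleFactor, particleFactor, Finset.prod_range_succ]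
    ring

theorem Gamma_one_add_hole {ν : ℂ} (hν : ∀ n : ℤ, ν ≠ n) (h : ℕ) :
    Complex.Gamma (1 + (h : ℂ) - ν) = (-1) ^ (h + 1) * holeFactor ν h * Complex.Gamma (-ν) := by
  induction h with
  | zero =>
    have h : -ν ≠ 0 := fun h => hν 0 (by push_cast; linear_combination -h)
    rw [show 1 + ((0 : ℕ) : ℂ) - ν = -ν + 1 by push_cast; ring, Complex.Gamma_add_one _ h]
    simp [holeFactor]
  | succ m ih =>
    have h : 1 + (m : ℂ) - ν ≠ 0 := fun h => hν (1 + m) (by push_cast; linear_combination -h)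
    rw [show 1 + ((m + 1 : ℕ) : ℂ) - ν = 1 + (m : ℂ) - ν + 1 by push_cast; ring,
      Complex.Gamma_add_one _ h, ih, holeFactor, holeFactor, Finset.prod_range_succ _ (m + 1)]
    push_cast
    ring

theorem sin_sq_mul_Gamma_sq {ν : ℂ} (hν : ∀ n : ℤ, ν ≠ n) :
    (Complex.sin ((π : ℂ) * ν) / (π : ℂ)) ^ 2 *
      (Complex.Gamma (1 + ν) ^ 2 * Complex.Gamma (-ν) ^ 2) = 1 := by
  have hs : Complex.sin ((π : ℂ) * ν) ≠ 0 := by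
    rw [Complex.sin_ne_zero_iff]
    intro n hn
    have hpi : (π : ℂ) ≠ 0 := by exact_mod_cast Real.pi_ne_zero
    exact hν n (mul_left_cancel₀ hpi (by rw [hn]; ring))
  have hpi : (π : ℂ) ≠ 0 := by exact_mod_cast Real.pi_ne_zero
  have h := Complex.Gamma_mul_Gamma_one_sub (-ν)
  rw [sub_neg_eq_add, mul_neg, Complex.sin_neg] at h
  rw [← mul_pow, mul_comm (Complex.Gamma (1 + ν)), h, ← mul_pow]
  field_simp

theorem Rweight_eq {ν : ℂ} (hν : ∀ n : ℤ, ν ≠ n) (Z : PHConfig) (hZ : Z.np = Z.nh) :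
    Rweight Z ν = hookWeight (Finset.univ.image Z.p) (Finset.univ.image Z.h) *
      contentProd ν (Finset.univ.image Z.p) (Finset.univ.image Z.h) *
      contentProd ν (Finset.univ.image Z.p) (Finset.univ.image Z.h) := by
  have hp := Z.p_mono.injective
  have hh := Z.h_mono.injective
  have hlt : ∀ {n : ℕ} (l : Fin n → ℕ), Function.Injective l →
      (∏ a : Fin n, ∏ b : Fin n, if a < b then ((l a : ℂ) - (l b : ℂ)) ^ 2 else 1) =
        distProd (Finset.univ.image l) (Finset.univ.image l) := by
    intro n l hl
    rw [← prod_offDiagDist_eq_distProd l hl, ← prod_Ioi_sq_eq_prod_offDiagDist l hl]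
    refine Finset.prod_congr rfl fun a _ => ?_
    rw [← Finset.prod_filter, Finset.filter_lt_eq_Ioi]
  have hP : ∏ a : Fin Z.np,
      Complex.Gamma (1 + (Z.p a : ℂ) + ν) ^ 2 / Complex.Gamma (1 + (Z.p a : ℂ)) ^ 2 =
      (Complex.Gamma (1 + ν) ^ 2) ^ Z.nh * ((∏ a, particleFactor ν (Z.p a)) ^ 2 /
        ∏ a, ((Z.p a).factorial : ℂ) ^ 2) := by
    rw [← hZ, ← Finset.prod_pow, ← Finset.prod_div_distrib, ← Fin.prod_const,
      ← Finset.prod_mul_distrib]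
    refine Finset.prod_congr rfl fun a _ => ?_
    rw [Gamma_one_add_particle hν, add_comm 1 (Z.p a : ℂ), Complex.Gamma_nat_eq_factorial]
    ring
  have hH : ∏ a : Fin Z.nh,
      Complex.Gamma (1 + (Z.h a : ℂ) - ν) ^ 2 / Complex.Gamma (1 + (Z.h a : ℂ)) ^ 2 =
      (Complex.Gamma (-ν) ^ 2) ^ Z.nh * ((∏ a, holeFactor ν (Z.h a)) ^ 2 /
        ∏ a, ((Z.h a).factorial : ℂ) ^ 2) := by
    rw [← Finset.prod_pow, ← Finset.prod_div_distrib, ← Fin.prod_const, ← Finset.prod_mul_distrib]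
    refine Finset.prod_congr rfl fun a _ => ?_
    rw [Gamma_one_add_hole hν, add_comm 1, Complex.Gamma_nat_eq_factorial, mul_pow, mul_pow,
      ← pow_mul, mul_comm (Z.h a + 1), pow_mul]
    ring
  have hG : (Complex.sin ((π : ℂ) * ν) / (π : ℂ)) ^ (2 * Z.nh) *
      ((Complex.Gamma (1 + ν) ^ 2) ^ Z.nh * (Complex.Gamma (-ν) ^ 2) ^ Z.nh) = 1 := by
    rw [pow_mul, ← mul_pow, ← mul_pow, sin_sq_mul_Gamma_sq hν, one_pow]
  rw [Rweight, hlt _ hp, hlt _ hh, hP, hH, hookWeight, contentProd]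
  simp only [Finset.prod_image hp.injOn, Finset.prod_image hh.injOn, Finset.prod_pow]
  linear_combination ((distProd (Finset.univ.image Z.p) (Finset.univ.image Z.p) : ℂ) *
    distProd (Finset.univ.image Z.h) (Finset.univ.image Z.h) /
    (∏ a, ∏ b, ((Z.h a : ℂ) + Z.p b + 1)) ^ 2 *
    ((∏ a, particleFactor ν (Z.p a)) ^ 2 / (∏ a, ((Z.p a).factorial : ℂ)) ^ 2) *
    ((∏ a, holeFactor ν (Z.h a)) ^ 2 / (∏ a, ((Z.h a).factorial : ℂ)) ^ 2)) * hG

theorem Jmom_eq_momentum (Z : PHConfig) :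
    Jmom Z = momentum (Finset.univ.image Z.p) (Finset.univ.image Z.h) := by
  rw [Jmom, momentum, Finset.sum_image Z.p_mono.injective.injOn,
    Finset.sum_image Z.h_mono.injective.injOn]

/-- The configuration with given sets of particles and holes. -/
noncomputable def PHConfig.ofFinsets (P H : Finset ℕ) : PHConfig where
  np := P.card
  nh := H.card
  p := P.orderEmbOfFin rfl
  h := H.orderEmbOfFin rfl
  p_mono := (P.orderEmbOfFin rfl).strictMono
  h_mono := (H.orderEmbOfFin rfl).strictMono

theorem PHConfig.image_p_ofFinsets (P H : Finset ℕ) :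
    Finset.univ.image (PHConfig.ofFinsets P H).p = P :=
  Finset.image_orderEmbOfFin_univ P rfl

theorem PHConfig.image_h_ofFinsets (P H : Finset ℕ) :
    Finset.univ.image (PHConfig.ofFinsets P H).h = H :=
  Finset.image_orderEmbOfFin_univ H rfl

theorem PHConfig.ofFinsets_image (Z : PHConfig) :
    PHConfig.ofFinsets (Finset.univ.image Z.p) (Finset.univ.image Z.h) = Z := by
  have key : ∀ {n m : ℕ} (l : Fin n → ℕ) (l' : Fin m → ℕ), StrictMono l → StrictMono l' →
      Finset.univ.image l = Finset.univ.image l' → n = m ∧ HEq l l' := by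
    intro n m l l' hl hl' h
    have hnm := congrArg Finset.card h
    rw [Finset.card_image_of_injective _ hl.injective,
      Finset.card_image_of_injective _ hl'.injective, Finset.card_fin, Finset.card_fin] at hnm
    subst hnm
    refine ⟨rfl, heq_of_eq ((StrictMono.range_inj hl hl').1 ?_)⟩
    simpa using congrArg (fun s : Finset ℕ => (s : Set ℕ)) h
  set Y := PHConfig.ofFinsets (Finset.univ.image Z.p) (Finset.univ.image Z.h) with hY
  have h1 := key Y.p Z.p Y.p_mono Z.p_mono (PHConfig.image_p_ofFinsets _ _)
  have h2 := key Y.h Z.h Y.h_mono Z.h_mono (PHConfig.image_h_ofFinsets _ _)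
  clear_value Y
  clear hY
  obtain ⟨np, nh, p, h, hp, hh⟩ := Z
  obtain ⟨np', nh', p', h', hp', hh'⟩ := Y
  obtain ⟨rfl, h1⟩ := h1
  obtain ⟨rfl, h2⟩ := h2
  cases h1
  cases h2
  rfl

/-- Balanced configurations are balanced pairs of finite sets, graded by momentum. -/
noncomputable def sigmaBalancedPairsEquiv :
    (Σ N : ℕ, {x // x ∈ balancedPairs N}) ≃ {Z : PHConfig // Z.np = Z.nh} :=
  Equiv.ofBijective
    (fun y => ⟨PHConfig.ofFinsets y.2.1.1 y.2.1.2, (mem_balancedPairs.1 y.2.2).1⟩) <| by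
    constructor
    · rintro ⟨N, ⟨⟨P, H⟩, hx⟩⟩ ⟨M, ⟨⟨P', H'⟩, hx'⟩⟩ h
      have h := congrArg Subtype.val h
      simp only at h
      have hP := PHConfig.image_p_ofFinsets P H
      have hH := PHConfig.image_h_ofFinsets P H
      rw [h, PHConfig.image_p_ofFinsets] at hP
      rw [h, PHConfig.image_h_ofFinsets] at hH
      subst hP hH
      obtain rfl := (mem_balancedPairs.1 hx).2
      obtain rfl := (mem_balancedPairs.1 hx').2
      rfl
    · rintro ⟨Z, hZ⟩
      refine ⟨⟨Jmom Z, (Finset.univ.image Z.p, Finset.univ.image Z.h), ?_⟩,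
        Subtype.ext Z.ofFinsets_image⟩
      rw [mem_balancedPairs, Jmom_eq_momentum, Finset.card_image_of_injective _ Z.p_mono.injective,
        Finset.card_image_of_injective _ Z.h_mono.injective]
      simpa using hZ

theorem pow_Jmom_mul_Rweight_sigmaBalancedPairsEquiv {ν : ℂ} (hν : ∀ n : ℤ, ν ≠ n) (z : ℂ)
    (y : Σ N : ℕ, {x // x ∈ balancedPairs N}) :
    z ^ Jmom (sigmaBalancedPairsEquiv y).1 * Rweight (sigmaBalancedPairsEquiv y).1 ν =
      z ^ y.1 * (hookWeight y.2.1.1 y.2.1.2 * contentProd ν y.2.1.1 y.2.1.2 *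
        contentProd ν y.2.1.1 y.2.1.2) := by
  have h : (sigmaBalancedPairsEquiv y).1 = PHConfig.ofFinsets y.2.1.1 y.2.1.2 := rfl
  rw [Rweight_eq hν _ (sigmaBalancedPairsEquiv y).2, Jmom_eq_momentum, h,
    PHConfig.image_p_ofFinsets, PHConfig.image_h_ofFinsets, (mem_balancedPairs.1 y.2.2).2]

/-- Restricted sum ("magic formula") in the balanced case: for `ν ∈ ℂ \ ℤ` and `|z| < 1`, the
family `z^{J(Z)} R(Z|ν)` over configurations with `n_p = n_h` is absolutely summable with sum
`(1 − z)^{−ν²}`. -/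
theorem restricted_sum_balanced (ν z : ℂ) (hν : ∀ n : ℤ, ν ≠ (n : ℂ)) (hz : ‖z‖ < 1) :
    Summable (fun Z : {Z : PHConfig // Z.np = Z.nh} => ‖z ^ Jmom Z.1 * Rweight Z.1 ν‖) ∧
    (∑' Z : {Z : PHConfig // Z.np = Z.nh}, z ^ Jmom Z.1 * Rweight Z.1 ν) =
      (1 - z) ^ (-(ν ^ 2)) := by
  have hconj : ∀ n : ℤ, starRingEnd ℂ ν ≠ n := fun n h => hν n (by
    simpa using congrArg (starRingEnd ℂ) h)
  have hnorm : Summable (fun Z : {Z : PHConfig // Z.np = Z.nh} =>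
      ‖z ^ Jmom Z.1 * Rweight Z.1 ν‖) := by
    rw [← sigmaBalancedPairsEquiv.summable_iff]
    simp only [Function.comp_def, pow_Jmom_mul_Rweight_sigmaBalancedPairsEquiv hν]
    rw [summable_sigma_of_nonneg fun _ => norm_nonneg _]
    refine ⟨fun N => (hasSum_fintype _).summable, ?_⟩
    have h := (hasSum_choose_mul_pow (ν * starRingEnd ℂ ν) (z := (‖z‖ : ℂ))
      (by simpa using hz)).summable
    rw [← Complex.summable_ofReal]
    refine h.congr fun N => ?_
    rw [← contentSum_eq_choose N ν _ hconj, contentSum, tsum_fintype,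
      Finset.sum_coe_sort (balancedPairs N) fun x =>
        ‖z ^ N * (hookWeight x.1 x.2 * contentProd ν x.1 x.2 * contentProd ν x.1 x.2)‖]
    simp only [norm_mul (z ^ N), norm_pow]
    push_cast
    rw [Finset.mul_sum]
    simp only [norm_hookWeight_mul_contentProd_sq]
  refine ⟨hnorm, ?_⟩
  have hsum := hnorm.of_norm
  rw [← sigmaBalancedPairsEquiv.tsum_eq]
  rw [← sigmaBalancedPairsEquiv.summable_iff] at hsum
  simp only [Function.comp_def, pow_Jmom_mul_Rweight_sigmaBalancedPairsEquiv hν] at hsum ⊢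
  rw [hsum.tsum_sigma, sq, ← (hasSum_choose_mul_pow (ν * ν) hz).tsum_eq]
  refine tsum_congr fun N => ?_
  rw [← contentSum_eq_choose N ν _ hν, contentSum, tsum_fintype, Finset.mul_sum]
  exact Finset.sum_coe_sort (balancedPairs N) fun x =>
    z ^ N * (hookWeight x.1 x.2 * contentProd ν x.1 x.2 * contentProd ν x.1 x.2)
end

section
/- Let K : ℝ → ℝ be continuous, q > 0, m ∈ ℝ, and set θ(x) = 2π ∫_0^x K(u) du. Suppose φ₊, φ₋ : ℝ → ℝ are continuous and satisfy, for all λ ∈ ℝ, φ_±(λ) + ∫_{−q}^{q} K(λ − ν) φ_±(ν) dν = (1/2π) θ(λ ∓ q) + m/2. Suppose moreover that the only continuous G : [−q,q] → ℝ with G(λ) + ∫_{−q}^{q} K(λ − ν) G(ν) dν = 0 for all λ ∈ [−q,q] is G ≡ 0, and let Z : ℝ → ℝ be a continuous solution of the dressed charge equation Z(λ) + ∫_{−q}^{q} K(λ − μ) Z(μ) dμ = 1 for all λ ∈ ℝ. Then φ₊(λ) − φ₋(λ) + 1 = Z(λ) for all λ ∈ ℝ. -/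
open MeasureTheory Real intervalIntegral

/-- Identity `φ₁(λ,q) − φ₁(λ,−q) + 1 = Z(λ)` relating the dressed phases and the dressed
charge: if `φ₊, φ₋` solve the dressed-phase equations with driving terms
`(1/2π)θ(λ ∓ q) + m/2`, `Z` solves the dressed-charge equation, and the homogeneous
Fredholm equation on `[−q,q]` has only the trivial continuous solution, then
`φ₊ − φ₋ + 1 = Z` everywhere. -/
theorem dressed_phase_charge_identity (K : ℝ → ℝ) (hK : Continuous K) (q m : ℝ) (hq : 0 < q)
    (θ : ℝ → ℝ) (hθ : ∀ x : ℝ, θ x = 2 * π * ∫ u in (0 : ℝ)..x, K u)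
    (φp φm : ℝ → ℝ) (hφpc : Continuous φp) (hφmc : Continuous φm)
    (hφp : ∀ x : ℝ, φp x + ∫ ν in (-q)..q, K (x - ν) * φp ν = (1 / (2 * π)) * θ (x - q) + m / 2)
    (hφm : ∀ x : ℝ, φm x + ∫ ν in (-q)..q, K (x - ν) * φm ν = (1 / (2 * π)) * θ (x + q) + m / 2)
    (huniq : ∀ G : ℝ → ℝ, ContinuousOn G (Set.Icc (-q) q) →
      (∀ x ∈ Set.Icc (-q) q, G x + ∫ ν in (-q)..q, K (x - ν) * G ν = 0) →
      ∀ x ∈ Set.Icc (-q) q, G x = 0)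
    (Z : ℝ → ℝ) (hZc : Continuous Z)
    (hZ : ∀ x : ℝ, Z x + ∫ μ in (-q)..q, K (x - μ) * Z μ = 1) :
    ∀ x : ℝ, φp x - φm x + 1 = Z x := by
  have hKx (x : ℝ) : Continuous fun ν => K (x - ν) := by fun_prop
  have hdriving (x : ℝ) : (1 / (2 * π)) * θ (x - q) - (1 / (2 * π)) * θ (x + q)
      + ∫ ν in (-q)..q, K (x - ν) = 0 := by
    have hsub : ∫ ν in (-q)..q, K (x - ν) = ∫ u in (x - q)..(x + q), K u := by
      rw [intervalIntegral.integral_comp_sub_left, sub_neg_eq_add]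
    have hadd := integral_add_adjacent_intervals
      (hK.intervalIntegrable (μ := volume) 0 (x - q)) (hK.intervalIntegrable (x - q) (x + q))
    rw [hsub, hθ, hθ, ← hadd]
    field_simp
    ring
  have hhom (x : ℝ) : (φp x - φm x + 1 - Z x)
      + ∫ ν in (-q)..q, K (x - ν) * (φp ν - φm ν + 1 - Z ν) = 0 := by
    have hi {f : ℝ → ℝ} (hf : Continuous f) :
        IntervalIntegrable (fun ν => K (x - ν) * f ν) volume (-q) q :=
      ((hKx x).mul hf).intervalIntegrable _ _
    have hsplit : ∫ ν in (-q)..q, K (x - ν) * (φp ν - φm ν + 1 - Z ν)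
        = (∫ ν in (-q)..q, K (x - ν) * φp ν) - (∫ ν in (-q)..q, K (x - ν) * φm ν)
          + (∫ ν in (-q)..q, K (x - ν)) - ∫ ν in (-q)..q, K (x - ν) * Z ν := by
      have hKi := (hKx x).intervalIntegrable (μ := volume) (-q) q
      rw [← integral_sub (hi hφpc) (hi hφmc), ← integral_add ((hi hφpc).sub (hi hφmc)) hKi,
        ← integral_sub (((hi hφpc).sub (hi hφmc)).add hKi) (hi hZc)]
      congr 1 with ν
      ring
    rw [hsplit]
    linarith [hφp x, hφm x, hZ x, hdriving x]
  have hzero := huniq (fun x => φp x - φm x + 1 - Z x) (by fun_prop) fun x _ => hhom x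
  intro x
  have hint : ∫ ν in (-q)..q, K (x - ν) * (φp ν - φm ν + 1 - Z ν) = 0 := by
    refine integral_zero_ae (.of_forall fun ν hν => ?_)
    rw [Set.uIoc_of_le (by linarith)] at hν
    exact mul_eq_zero_of_right _ (hzero ν (Set.Ioc_subset_Icc_self hν))
  linarith [hhom x]
end

section
/- Let L > 0 and ε ∈ {−1, 1}, and let ξ, f : ℝ → ℂ be continuously differentiable with Re(iεξ(x)) < 0 for every x ∈ ℝ and f(x) → 0 as x → ±∞. Assume that the functions x ↦ ξ′(x) f(x) / (e^{−iεLξ(x)} − 1) and x ↦ f′(x) · Log(1 − e^{iεLξ(x)}) are integrable on ℝ. Then ∫_ℝ (−ε) ξ′(x) f(x) / (e^{−iεLξ(x)} − 1) dx = (i/L) ∫_ℝ f′(x) · Log(1 − e^{iεLξ(x)}) dx, where Log is the principal complex logarithm. -/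
open MeasureTheory Real Filter

/-- If `f → 0` at `+∞` and `f' g` is integrable, then `f g` has no nonzero limit there:
otherwise the logarithmic derivative `f' / f` would be integrable near `+∞`, and `f` would converge
to a nonzero value. -/
lemma eq_zero_of_tendsto_mul_of_integrable_deriv_mul {f f' g : ℝ → ℂ} {c : ℂ}
    (hf : ∀ x, HasDerivAt f (f' x) x) (hf' : Continuous f')
    (hint : Integrable (fun x => f' x * g x)) (hf0 : Tendsto f atTop (nhds 0))
    (hfg : Tendsto (fun x => f x * g x) atTop (nhds c)) : c = 0 := by
  by_contra hc
  have hcpos : 0 < ‖c‖ := norm_pos_iff.2 hc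
  have hev : ∀ᶠ x in atTop, ‖c‖ / 2 < ‖f x * g x‖ :=
    hfg.norm.eventually (lt_mem_nhds (half_lt_self hcpos))
  obtain ⟨b, hb⟩ := eventually_atTop.1 hev
  have hne : ∀ x, b ≤ x → f x ≠ 0 := by
    intro x hx h0
    have := hb x hx
    simp only [h0, zero_mul, norm_zero] at this
    linarith
  have hfc : Continuous f := continuous_iff_continuousAt.2 fun x => (hf x).continuousAt
  let a := b + 1
  let u : ℝ → ℂ := fun x => f' x / f x
  have hucont : ∀ x, b ≤ x → ContinuousAt u x := fun x hx =>
    hf'.continuousAt.div hfc.continuousAt (hne x hx)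
  have humeas : Measurable u := hf'.measurable.div hfc.measurable
  have huint : IntegrableOn u (Set.Ioi a) := by
    refine Integrable.mono' ((hint.norm.const_mul (2 / ‖c‖)).integrableOn)
      humeas.aestronglyMeasurable ?_
    refine (ae_restrict_iff' measurableSet_Ioi).2 (Eventually.of_forall fun x hx => ?_)
    have hbx : b ≤ x := by
      have : b + 1 < x := hx
      linarith
    have hfx : 0 < ‖f x‖ := norm_pos_iff.2 (hne x hbx)
    have hlow := hb x hbx
    simp only [u, norm_div, norm_mul] at hlow ⊢
    rw [div_mul_eq_mul_div, div_le_div_iff₀ hfx hcpos]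
    nlinarith [norm_nonneg (f' x)]
  have huii : ∀ x, a ≤ x → IntervalIntegrable u volume a x := fun x hx =>
    (intervalIntegrable_iff_integrableOn_Ioc_of_le hx).2 (huint.mono_set Set.Ioc_subset_Ioi_self)
  let φ : ℝ → ℂ := fun x => ∫ t in a..x, u t
  have hφ : ∀ x, a ≤ x → HasDerivAt φ (u x) x := fun x hx =>
    intervalIntegral.integral_hasDerivAt_right (huii x hx)
      humeas.stronglyMeasurable.stronglyMeasurableAtFilter
      (hucont x (by simp only [a] at hx; linarith))
  have hderiv : ∀ x, a ≤ x → HasDerivAt (fun y => f y * Complex.exp (-φ y)) 0 x := by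
    intro x hx
    have hfx : f x ≠ 0 := hne x (by simp only [a] at hx; linarith)
    refine ((hf x).mul (hφ x hx).neg.cexp).congr_deriv ?_
    simp only [u]
    field_simp
    ring
  have hconst : ∀ x, a ≤ x → f x * Complex.exp (-φ x) = f a := by
    intro x hx
    have := constant_of_has_deriv_right_zero (a := a) (b := x)
      (fun y hy => (hderiv y hy.1).continuousAt.continuousWithinAt)
      (fun y hy => (hderiv y hy.1).hasDerivWithinAt) x ⟨hx, le_rfl⟩
    simpa [φ] using this
  have hlim : Tendsto (fun x => f x * Complex.exp (-φ x)) atTop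
      (nhds (0 * Complex.exp (-∫ t in Set.Ioi a, u t))) :=
    hf0.mul (intervalIntegral_tendsto_integral_Ioi a huint tendsto_id).neg.cexp
  have hlim' : Tendsto (fun x => f x * Complex.exp (-φ x)) atTop (nhds (f a)) :=
    tendsto_const_nhds.congr' ((eventually_ge_atTop a).mono fun x hx => (hconst x hx).symm)
  exact hne a (by simp [a]) (by simpa using tendsto_nhds_unique hlim' hlim)

lemma tendsto_mul_atTop_zero_of_integrable {f f' g g' : ℝ → ℂ}
    (hf : ∀ x, HasDerivAt f (f' x) x) (hf' : Continuous f') (hg : ∀ x, HasDerivAt g (g' x) x)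
    (hint : Integrable (fun x => f' x * g x)) (hint' : Integrable (fun x => f x * g' x))
    (hf0 : Tendsto f atTop (nhds 0)) : Tendsto (fun x => f x * g x) atTop (nhds 0) := by
  have hlim := tendsto_limUnder_of_hasDerivAt_of_integrableOn_Ioi (a := 0)
    (fun x _ => (hf x).mul (hg x)) (hint.add hint').integrableOn
  have h0 := eq_zero_of_tendsto_mul_of_integrable_deriv_mul hf hf' hint hf0 hlim
  rwa [h0] at hlim

lemma tendsto_mul_atBot_zero_of_integrable {f f' g g' : ℝ → ℂ}
    (hf : ∀ x, HasDerivAt f (f' x) x) (hf' : Continuous f') (hg : ∀ x, HasDerivAt g (g' x) x)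
    (hint : Integrable (fun x => f' x * g x)) (hint' : Integrable (fun x => f x * g' x))
    (hf0 : Tendsto f atBot (nhds 0)) : Tendsto (fun x => f x * g x) atBot (nhds 0) := by
  have hneg : ∀ {h h' : ℝ → ℂ}, (∀ x, HasDerivAt h (h' x) x) →
      ∀ x, HasDerivAt (fun y => h (-y)) (-h' (-x)) x := fun hh x => by
    simpa [Function.comp_def] using (hh (-x)).scomp x (hasDerivAt_neg x)
  have key := tendsto_mul_atTop_zero_of_integrable (hneg hf) (hf'.comp continuous_neg).neg (hneg hg)
    (by simpa using hint.comp_neg.neg) (by simpa using hint'.comp_neg.neg)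
    (hf0.comp tendsto_neg_atTop_atBot)
  simpa [Function.comp_def] using key.comp tendsto_neg_atBot_atTop

/-- The derivative of `x ↦ Log (1 - exp (w x))` for `w` with values in the left half-plane. -/
lemma hasDerivAt_log_one_sub_exp {w : ℝ → ℂ} {w' : ℂ} {x : ℝ} (hw : HasDerivAt w w' x)
    (hre : (w x).re < 0) :
    HasDerivAt (fun y => Complex.log (1 - Complex.exp (w y)))
      (-w' / (Complex.exp (-w x) - 1)) x := by
  have hnorm : ‖Complex.exp (w x)‖ < 1 := by
    rw [Complex.norm_exp]
    simpa using hre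
  have hpos : 0 < (1 - Complex.exp (w x)).re := by
    have := Complex.re_le_norm (Complex.exp (w x))
    simp only [Complex.sub_re, Complex.one_re]
    linarith
  have hne : 1 - Complex.exp (w x) ≠ 0 := fun h => by simp [h] at hpos
  refine ((hw.cexp.const_sub 1).clog_real (Or.inl hpos)).congr_deriv ?_
  have he : Complex.exp (-w x) - 1 = (1 - Complex.exp (w x)) / Complex.exp (w x) := by
    rw [Complex.exp_neg, sub_div, div_self (Complex.exp_ne_zero _), one_div]
  rw [he]
  have := Complex.exp_ne_zero (w x)
  field_simp

/-- Integration-by-parts identity trading the singular factor `(e^{−iεLξ}−1)^{−1}` for the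
principal logarithm `Log(1 − e^{iεLξ})`: for `L > 0`, `ε ∈ {±1}`, `ξ, f` continuously
differentiable with `Re(iεξ(x)) < 0` everywhere and `f` vanishing at `±∞`,
`∫_ℝ (−ε) ξ′ f/(e^{−iεLξ}−1) dx = (i/L) ∫_ℝ f′ · Log(1 − e^{iεLξ}) dx`. -/
theorem integration_by_parts_log (L ε : ℝ) (hL : 0 < L) (hε : ε = 1 ∨ ε = -1)
    (ξ f : ℝ → ℂ) (hξ : ContDiff ℝ 1 ξ) (hf : ContDiff ℝ 1 f)
    (hre : ∀ x : ℝ, (Complex.I * (ε : ℂ) * ξ x).re < 0)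
    (hftop : Tendsto f atTop (nhds 0)) (hfbot : Tendsto f atBot (nhds 0))
    (hint1 : Integrable (fun x : ℝ =>
      deriv ξ x * f x / (Complex.exp (-Complex.I * (ε : ℂ) * (L : ℂ) * ξ x) - 1)))
    (hint2 : Integrable (fun x : ℝ =>
      deriv f x * Complex.log (1 - Complex.exp (Complex.I * (ε : ℂ) * (L : ℂ) * ξ x)))) :
    (∫ x : ℝ, (-(ε : ℂ)) * deriv ξ x * f x /
        (Complex.exp (-Complex.I * (ε : ℂ) * (L : ℂ) * ξ x) - 1)) =
      (Complex.I / (L : ℂ)) *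
        ∫ x : ℝ, deriv f x * Complex.log (1 - Complex.exp (Complex.I * (ε : ℂ) * (L : ℂ) * ξ x)) := by
  have hL' : (L : ℂ) ≠ 0 := by exact_mod_cast hL.ne'
  have hfd : ∀ x, HasDerivAt f (deriv f x) x := fun x =>
    ((hf.differentiable one_ne_zero) x).hasDerivAt
  have hgd : ∀ x, HasDerivAt
      (fun y => Complex.log (1 - Complex.exp (Complex.I * (ε : ℂ) * (L : ℂ) * ξ y)))
      (-(Complex.I * (ε : ℂ) * (L : ℂ) * deriv ξ x) /
        (Complex.exp (-Complex.I * (ε : ℂ) * (L : ℂ) * ξ x) - 1)) x := by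
    intro x
    have hre' : (Complex.I * (ε : ℂ) * (L : ℂ) * ξ x).re < 0 := by
      have h : Complex.I * (ε : ℂ) * (L : ℂ) * ξ x = (L : ℂ) * (Complex.I * (ε : ℂ) * ξ x) := by
        ring
      rw [h, Complex.re_ofReal_mul]
      exact mul_neg_of_pos_of_neg hL (hre x)
    have h := hasDerivAt_log_one_sub_exp
      (((hξ.differentiable one_ne_zero) x).hasDerivAt.const_mul
        (Complex.I * (ε : ℂ) * (L : ℂ))) hre'
    simpa only [neg_mul] using h
  have hint : Integrable (fun x => f x * (-(Complex.I * (ε : ℂ) * (L : ℂ) * deriv ξ x) /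
      (Complex.exp (-Complex.I * (ε : ℂ) * (L : ℂ) * ξ x) - 1))) := by
    refine (hint1.const_mul (-(Complex.I * (ε : ℂ) * (L : ℂ)))).congr
      (Eventually.of_forall fun x => ?_)
    ring
  have hf' := hf.continuous_deriv le_rfl
  have key := integral_mul_deriv_eq_deriv_mul (fun x _ => hfd x) (fun x _ => hgd x) hint hint2
    (tendsto_mul_atBot_zero_of_integrable hfd hf' hgd hint2 hint hfbot)
    (tendsto_mul_atTop_zero_of_integrable hfd hf' hgd hint2 hint hftop)
  rw [sub_zero, zero_sub] at key
  rw [← neg_eq_iff_eq_neg.2 key, ← integral_neg, ← integral_const_mul]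
  congr 1
  funext x
  calc _ = (Complex.I * Complex.I) * ((L : ℂ) / L) * ((ε : ℂ) * deriv ξ x * f x /
        (Complex.exp (-Complex.I * (ε : ℂ) * (L : ℂ) * ξ x) - 1)) := by
        rw [Complex.I_mul_I, div_self hL']
        ring
    _ = _ := by ring
end

section
/- For all κ > 0, L > 0, and M₀ ≥ 1, the integral −∫_{ln M₀}^{∞} e^{−2x} · ln(1 − e^{−κ L e^{−2x}}) dx is well defined, nonnegative, and bounded above by π²/(12 κ L). -/
open MeasureTheory Real

/-- The integrand `e^{−2x} ln(1 − e^{−κL e^{−2x}})` appearing in the tail estimate. -/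
noncomputable def tailIntegrand (κ L : ℝ) (x : ℝ) : ℝ :=
  Real.exp (-(2 * x)) * Real.log (1 - Real.exp (-(κ * L * Real.exp (-(2 * x)))))

/-- The `n`-th term of the expansion of `-e^{-2x} ln(1 - e^{-c e^{-2x}})` in powers of
`e^{-c e^{-2x}}`. -/
noncomputable def tailTerm (c : ℝ) (n : ℕ) (x : ℝ) : ℝ :=
  Real.exp (-(2 * x)) * (Real.exp (-(c * Real.exp (-(2 * x)))) ^ (n + 1) / (n + 1))

lemma tailTerm_nonneg (c : ℝ) (n : ℕ) (x : ℝ) : 0 ≤ tailTerm c n x := by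
  unfold tailTerm
  positivity

lemma measurable_tailTerm (c : ℝ) (n : ℕ) : Measurable (tailTerm c n) := by
  unfold tailTerm
  fun_prop

lemma measurable_tailIntegrand (κ L : ℝ) : Measurable (tailIntegrand κ L) := by
  unfold tailIntegrand
  fun_prop

lemma hasSum_tailTerm {κ L : ℝ} (hc : 0 < κ * L) (x : ℝ) :
    HasSum (fun n => tailTerm (κ * L) n x) (-tailIntegrand κ L x) := by
  have h : |Real.exp (-(κ * L * Real.exp (-(2 * x))))| < 1 := by
    rw [abs_of_pos (Real.exp_pos _), Real.exp_lt_one_iff]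
    have := Real.exp_pos (-(2 * x))
    have := mul_pos hc this
    linarith
  simpa [tailTerm, tailIntegrand] using
    (hasSum_pow_div_log_of_abs_lt_one h).mul_left (Real.exp (-(2 * x)))

lemma hasDerivAt_tailTerm_primitive {c : ℝ} (hc : 0 < c) (n : ℕ) (x : ℝ) :
    HasDerivAt (fun x => Real.exp (-(c * Real.exp (-(2 * x)))) ^ (n + 1) /
      (2 * c * ((n : ℝ) + 1) ^ 2)) (tailTerm c n x) x := by
  have h1 : HasDerivAt (fun x : ℝ => -(2 * x)) (-(2 * 1)) x :=
    ((hasDerivAt_id x).const_mul 2).neg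
  have h2 := (((h1.exp.const_mul c).neg.exp.pow (n + 1)).div_const (2 * c * ((n : ℝ) + 1) ^ 2))
  refine h2.congr_deriv ?_
  have hn : (n : ℝ) + 1 ≠ 0 := by positivity
  simp only [tailTerm, Nat.add_sub_cancel, Pi.neg_apply]
  push_cast
  field_simp
  rw [pow_succ]

lemma tendsto_tailTerm_primitive (c : ℝ) (n : ℕ) :
    Filter.Tendsto (fun x => Real.exp (-(c * Real.exp (-(2 * x)))) ^ (n + 1) /
      (2 * c * ((n : ℝ) + 1) ^ 2)) Filter.atTop (nhds (1 / (2 * c * ((n : ℝ) + 1) ^ 2))) := by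
  have h1 : Filter.Tendsto (fun x : ℝ => Real.exp (-(2 * x))) Filter.atTop (nhds 0) :=
    Real.tendsto_exp_neg_atTop_nhds_zero.comp
      (Filter.tendsto_id.const_mul_atTop (two_pos : (0 : ℝ) < 2))
  have h2 := (Real.continuous_exp.tendsto _).comp (h1.const_mul c).neg
  simpa only [Function.comp_def, mul_zero, neg_zero, Real.exp_zero, one_pow] using
    (h2.pow (n + 1)).div_const (2 * c * ((n : ℝ) + 1) ^ 2)

lemma lintegral_tailTerm_le {c : ℝ} (hc : 0 < c) (n : ℕ) (a : ℝ) :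
    ∫⁻ x in Set.Ioi a, ENNReal.ofReal (tailTerm c n x) ≤
      ENNReal.ofReal (1 / (2 * c * ((n : ℝ) + 1) ^ 2)) := by
  have hint := integrableOn_Ioi_deriv_of_nonneg'
    (fun x (_ : x ∈ Set.Ici a) => hasDerivAt_tailTerm_primitive hc n x)
    (fun x _ => tailTerm_nonneg c n x) (tendsto_tailTerm_primitive c n)
  rw [← ofReal_integral_eq_lintegral_ofReal hint
    (Filter.Eventually.of_forall (tailTerm_nonneg c n)),
    integral_Ioi_of_hasDerivAt_of_nonneg'
    (fun x (_ : x ∈ Set.Ici a) => hasDerivAt_tailTerm_primitive hc n x)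
    (fun x _ => tailTerm_nonneg c n x) (tendsto_tailTerm_primitive c n)]
  refine ENNReal.ofReal_le_ofReal (sub_le_self _ ?_)
  positivity

lemma hasSum_tailTerm_bounds (c : ℝ) :
    HasSum (fun n : ℕ => 1 / (2 * c * ((n : ℝ) + 1) ^ 2)) (π ^ 2 / (12 * c)) := by
  have h := (hasSum_nat_add_iff' 1).mpr hasSum_zeta_two
  have h2 := h.mul_left (1 / (2 * c))
  have hval : 1 / (2 * c) * (π ^ 2 / 6 - ∑ i ∈ Finset.range 1, 1 / (i : ℝ) ^ 2) =
      π ^ 2 / (12 * c) := by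
    simp
    ring
  rw [hval] at h2
  simpa only [one_div_mul_one_div, Nat.cast_add, Nat.cast_one] using h2

lemma lintegral_neg_tailIntegrand_le {κ L : ℝ} (hc : 0 < κ * L) (a : ℝ) :
    ∫⁻ x in Set.Ioi a, ENNReal.ofReal (-tailIntegrand κ L x) ≤
      ENNReal.ofReal (π ^ 2 / (12 * (κ * L))) := by
  have hsum := hasSum_tailTerm_bounds (κ * L)
  calc ∫⁻ x in Set.Ioi a, ENNReal.ofReal (-tailIntegrand κ L x)
      = ∫⁻ x in Set.Ioi a, ∑' n, ENNReal.ofReal (tailTerm (κ * L) n x) := by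
        refine lintegral_congr fun x => ?_
        rw [← (hasSum_tailTerm hc x).tsum_eq, ENNReal.ofReal_tsum_of_nonneg
          (fun n => tailTerm_nonneg _ n x) (hasSum_tailTerm hc x).summable]
    _ = ∑' n, ∫⁻ x in Set.Ioi a, ENNReal.ofReal (tailTerm (κ * L) n x) :=
        lintegral_tsum fun n => (measurable_tailTerm _ n).ennreal_ofReal.aemeasurable
    _ ≤ ∑' n : ℕ, ENNReal.ofReal (1 / (2 * (κ * L) * ((n : ℝ) + 1) ^ 2)) :=
        ENNReal.tsum_le_tsum fun n => lintegral_tailTerm_le hc n a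
    _ = ENNReal.ofReal (π ^ 2 / (12 * (κ * L))) := by
        rw [← hsum.tsum_eq, ENNReal.ofReal_tsum_of_nonneg (fun n => by positivity) hsum.summable]

/-- For `κ, L > 0` and `M₀ ≥ 1`, the integral `−∫_{ln M₀}^∞ e^{−2x} ln(1 − e^{−κL e^{−2x}}) dx`
is well defined, nonnegative, and bounded above by `π²/(12 κ L)`. -/
theorem tail_log_integral_estimate (κ L M₀ : ℝ) (hκ : 0 < κ) (hL : 0 < L) (hM : 1 ≤ M₀) :
    IntegrableOn (tailIntegrand κ L) (Set.Ioi (Real.log M₀)) ∧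
    0 ≤ -(∫ x in Set.Ioi (Real.log M₀), tailIntegrand κ L x) ∧
    -(∫ x in Set.Ioi (Real.log M₀), tailIntegrand κ L x) ≤ π ^ 2 / (12 * κ * L) := by
  have hc : 0 < κ * L := mul_pos hκ hL
  have hle := lintegral_neg_tailIntegrand_le hc (Real.log M₀)
  have hnonneg : ∀ x, 0 ≤ -tailIntegrand κ L x := fun x =>
    (hasSum_tailTerm hc x).nonneg fun n => tailTerm_nonneg _ n x
  have hmeas : Measurable fun x => -tailIntegrand κ L x := (measurable_tailIntegrand κ L).neg
  refine ⟨?_, ?_, ?_⟩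
  · have hint : IntegrableOn (fun x => -tailIntegrand κ L x) (Set.Ioi (Real.log M₀)) :=
      (lintegral_ofReal_ne_top_iff_integrable hmeas.aestronglyMeasurable
        (Filter.Eventually.of_forall hnonneg)).mp (hle.trans_lt ENNReal.ofReal_lt_top).ne
    simpa using hint.neg
  · rw [← integral_neg]
    exact integral_nonneg hnonneg
  · rw [← integral_neg, integral_eq_lintegral_of_nonneg_ae
      (Filter.Eventually.of_forall hnonneg) hmeas.aestronglyMeasurable, mul_assoc]
    exact ENNReal.toReal_le_of_le_ofReal (by positivity) hle
end
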